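/- arXiv:1702.04529 — 3 statements merged into one kernel-verified Lean document; each statement's English description precedes it below -/
import Mathlib

section
/- For every positive integer n, the number of semi-Baxter permutations of size n equals the number of plane permutations of size n. (Corollary 3.4: semi-Baxter permutations and plane permutations are equinumerous.) -/
/-- `f` contains the vincular pattern 2-41-3: there are positions
`i < j` and `k > j+1` with `f (j+1) < f i < f k < f j`. -/
def Contains2413 {m : ℕ} (f : Fin m → Fin m) : Prop :=
  ∃ i j j' k : Fin m, (i : ℕ) < (j : ℕ) ∧ (j' : ℕ) = (j : ℕ) + 1 ∧ (j' : ℕ) < (k : ℕ) ∧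
    f j' < f i ∧ f i < f k ∧ f k < f j

/-- `f` contains the vincular pattern 2-14-3: there are positions
`i < j` and `k > j+1` with `f j < f i < f k < f (j+1)`. -/
def Contains2143 {m : ℕ} (f : Fin m → Fin m) : Prop :=
  ∃ i j j' k : Fin m, (i : ℕ) < (j : ℕ) ∧ (j' : ℕ) = (j : ℕ) + 1 ∧ (j' : ℕ) < (k : ℕ) ∧
    f j < f i ∧ f i < f k ∧ f k < f j'

/-- A semi-Baxter permutation avoids 2-41-3. -/
def IsSemiBaxter {n : ℕ} (π : Equiv.Perm (Fin n)) : Prop := ¬ Contains2413 ⇑π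

/-- A plane permutation avoids 2-14-3. -/
def IsPlane {n : ℕ} (π : Equiv.Perm (Fin n)) : Prop := ¬ Contains2143 ⇑π

noncomputable def semiBaxterCount (n : ℕ) : ℕ :=
  Nat.card {π : Equiv.Perm (Fin n) // IsSemiBaxter π}

noncomputable def planeCount (n : ℕ) : ℕ :=
  Nat.card {π : Equiv.Perm (Fin n) // IsPlane π}

open Finset

/-- The larger end of the adjacent pair `x y` when `b` prescribes a descent (`true`) or an
ascent (`false`). -/
def adjacentTop (b : Bool) (x y : ℕ) : ℕ := if b then x else y

/-- The smaller end of the adjacent pair `x y` when `b` prescribes a descent (`true`) or an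
ascent (`false`). -/
def adjacentBot (b : Bool) (x y : ℕ) : ℕ := if b then y else x

/-- Inserting on the right of `σ` a new last entry with exactly `c` smaller entries creates
an occurrence of 2-41-3 (`b = true`) or 2-14-3 (`b = false`). -/
def Blocked (b : Bool) {m : ℕ} (σ : Equiv.Perm (Fin m)) (c : ℕ) : Prop :=
  ∃ i j j' : Fin m, (i : ℕ) < (j : ℕ) ∧ (j' : ℕ) = (j : ℕ) + 1 ∧
    adjacentBot b (σ j) (σ j') < (σ i : ℕ) ∧ (σ i : ℕ) < c ∧ c ≤ adjacentTop b (σ j) (σ j')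

/-- `σ` contains 2-41-3 (`b = true`) or 2-14-3 (`b = false`). -/
def HasPattern (b : Bool) {m : ℕ} (σ : Equiv.Perm (Fin m)) : Prop :=
  ∃ i j j' k : Fin m, (i : ℕ) < (j : ℕ) ∧ (j' : ℕ) = (j : ℕ) + 1 ∧ (j' : ℕ) < (k : ℕ) ∧
    adjacentBot b (σ j) (σ j') < (σ i : ℕ) ∧ (σ i : ℕ) < σ k ∧
    (σ k : ℕ) < adjacentTop b (σ j) (σ j')

theorem hasPattern_true_iff {m : ℕ} (σ : Equiv.Perm (Fin m)) :
    HasPattern true σ ↔ Contains2413 σ := by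
  simp [HasPattern, Contains2413, adjacentBot, adjacentTop]

theorem hasPattern_false_iff {m : ℕ} (σ : Equiv.Perm (Fin m)) :
    HasPattern false σ ↔ Contains2143 σ := by
  simp [HasPattern, Contains2143, adjacentBot, adjacentTop]

/-- Append the value `a` to `σ`, raising the values that are at least `a`. -/
def appendValue {m : ℕ} (a : Fin (m + 1)) (σ : Equiv.Perm (Fin m)) :
    Equiv.Perm (Fin (m + 1)) :=
  (finSuccEquiv' (Fin.last m)).trans ((Equiv.optionCongr σ).trans (finSuccEquiv' a).symm)

theorem appendValue_last {m : ℕ} (a : Fin (m + 1)) (σ : Equiv.Perm (Fin m)) :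
    appendValue a σ (Fin.last m) = a := by
  simp [appendValue]

theorem appendValue_castSucc {m : ℕ} (a : Fin (m + 1)) (σ : Equiv.Perm (Fin m)) (i : Fin m) :
    appendValue a σ i.castSucc = a.succAbove (σ i) := by
  have h : finSuccEquiv' (Fin.last m) i.castSucc = some i := by
    rw [← Fin.succAbove_last, finSuccEquiv'_succAbove]
  simp [appendValue, h]

theorem val_appendValue_castSucc {m : ℕ} (a : Fin (m + 1)) (σ : Equiv.Perm (Fin m))
    (i : Fin m) :
    (appendValue a σ i.castSucc : ℕ) = if (σ i : ℕ) < a then (σ i : ℕ) else σ i + 1 := by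
  rw [appendValue_castSucc, Fin.succAbove]
  simp only [Fin.lt_def, Fin.val_castSucc]
  split_ifs <;> simp

theorem appendValue_bijective (m : ℕ) :
    Function.Bijective fun p : Fin (m + 1) × Equiv.Perm (Fin m) => appendValue p.1 p.2 := by
  rw [Fintype.bijective_iff_injective_and_card]
  constructor
  · rintro ⟨a, σ⟩ ⟨a', σ'⟩ h
    simp only at h
    obtain rfl : a = a' := by rw [← appendValue_last a σ, h, appendValue_last]
    refine Prod.ext rfl (Equiv.ext fun i => ?_)
    have := congrArg (fun e => e i.castSucc) h
    simpa [appendValue_castSucc] using this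
  · simp [Fintype.card_perm, Nat.factorial_succ]

/-- The site of a permutation from which the site `c` arises when `a` is appended. -/
def parentSite (a c : ℕ) : ℕ := if c ≤ a then c else c - 1

theorem val_appendValue_castSucc_lt_iff {m : ℕ} (a : Fin (m + 1)) (σ : Equiv.Perm (Fin m))
    (i : Fin m) (c : ℕ) :
    (appendValue a σ i.castSucc : ℕ) < c ↔ (σ i : ℕ) < parentSite a c := by
  rw [val_appendValue_castSucc, parentSite]
  split_ifs <;> omega

theorem val_appendValue_castSucc_lt_castSucc_iff {m : ℕ} (a : Fin (m + 1))
    (σ : Equiv.Perm (Fin m)) (i j : Fin m) :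
    (appendValue a σ i.castSucc : ℕ) < appendValue a σ j.castSucc ↔ (σ i : ℕ) < σ j := by
  simp only [val_appendValue_castSucc]
  split_ifs <;> omega

theorem hasPattern_appendValue_iff (b : Bool) {m : ℕ} (a : Fin (m + 1))
    (σ : Equiv.Perm (Fin m)) :
    HasPattern b (appendValue a σ) ↔ HasPattern b σ ∨ Blocked b σ a := by
  constructor
  · rintro ⟨i, j, j', k, hij, hj, hk, h⟩
    have hkm := k.isLt
    obtain ⟨i, rfl⟩ := Fin.exists_castSucc_eq.2 (Fin.ne_of_val_ne (by simp; omega) : i ≠ Fin.last m)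
    obtain ⟨j, rfl⟩ := Fin.exists_castSucc_eq.2 (Fin.ne_of_val_ne (by simp; omega) : j ≠ Fin.last m)
    obtain ⟨j', rfl⟩ :=
      Fin.exists_castSucc_eq.2 (Fin.ne_of_val_ne (by simp at hk ⊢; omega) : j' ≠ Fin.last m)
    induction k using Fin.lastCases with
    | last =>
      right
      refine ⟨i, j, j', hij, hj, ?_⟩
      rw [appendValue_last] at h
      cases b <;> simp only [adjacentBot, adjacentTop, val_appendValue_castSucc, if_true,
        Bool.false_eq_true, if_false] at h ⊢ <;> split_ifs at h <;> omega
    | cast k =>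
      left
      refine ⟨i, j, j', k, hij, hj, hk, ?_⟩
      cases b <;> simpa only [adjacentBot, adjacentTop, if_true, Bool.false_eq_true, if_false,
        val_appendValue_castSucc_lt_castSucc_iff] using h
  · rintro (⟨i, j, j', k, hij, hj, hk, h⟩ | ⟨i, j, j', hij, hj, h⟩)
    · refine ⟨i.castSucc, j.castSucc, j'.castSucc, k.castSucc, hij, hj, hk, ?_⟩
      cases b <;> simpa only [adjacentBot, adjacentTop, if_true, Bool.false_eq_true, if_false,
        val_appendValue_castSucc_lt_castSucc_iff] using h
    · refine ⟨i.castSucc, j.castSucc, j'.castSucc, Fin.last m, hij, hj, j'.isLt, ?_⟩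
      rw [appendValue_last]
      cases b <;> simp only [adjacentBot, adjacentTop, val_appendValue_castSucc, if_true,
        Bool.false_eq_true, if_false] at h ⊢ <;> split_ifs <;> omega

/-- The last value of a nonempty permutation. -/
def lastValue {n : ℕ} (σ : Equiv.Perm (Fin (n + 1))) : ℕ := σ (Fin.last n)

theorem lastValue_le {n : ℕ} (σ : Equiv.Perm (Fin (n + 1))) : lastValue σ ≤ n :=
  Nat.lt_succ_iff.1 (σ (Fin.last n)).isLt

theorem lastValue_appendValue {n : ℕ} (a : Fin (n + 2)) (σ : Equiv.Perm (Fin (n + 1))) :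
    lastValue (appendValue a σ) = a := by
  rw [lastValue, appendValue_last]

theorem exists_val_eq_of_ne_lastValue {n v : ℕ} (σ : Equiv.Perm (Fin (n + 1))) (hv : v ≤ n)
    (hne : v ≠ lastValue σ) : ∃ i : Fin (n + 1), (i : ℕ) < n ∧ (σ i : ℕ) = v := by
  refine ⟨σ.symm ⟨v, by omega⟩, ?_, by simp⟩
  by_contra h
  have : σ.symm ⟨v, by omega⟩ = Fin.last n := by
    apply Fin.ext
    have := (σ.symm ⟨v, by omega⟩).isLt
    simp only [Fin.val_last]
    omega
  rw [Equiv.symm_apply_eq] at this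
  exact hne (by rw [lastValue, ← this])

/-- An occurrence that uses the appended value appears exactly when the last adjacent pair is of
the prescribed kind and the remaining values leave room between its ends. -/
theorem blocked_appendValue_iff (b : Bool) {n : ℕ} (a : Fin (n + 2))
    (σ : Equiv.Perm (Fin (n + 1))) (c : ℕ) :
    Blocked b (appendValue a σ) c ↔ Blocked b σ (parentSite a c) ∨
      if b then (a : ℕ) + 2 ≤ c ∧ c ≤ lastValue σ + 1 else lastValue σ + 2 ≤ c ∧ c ≤ a := by
  have ha := a.isLt
  have hl := lastValue_le σ
  have hlast : (appendValue a σ (Fin.last n).castSucc : ℕ) =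
      if lastValue σ < a then lastValue σ else lastValue σ + 1 := val_appendValue_castSucc a σ _
  constructor
  · rintro ⟨i, j, j', hij, hj, h⟩
    have hjm := j'.isLt
    obtain ⟨i, rfl⟩ :=
      Fin.exists_castSucc_eq.2 (Fin.ne_of_val_ne (by simp; omega) : i ≠ Fin.last (n + 1))
    obtain ⟨j, rfl⟩ :=
      Fin.exists_castSucc_eq.2 (Fin.ne_of_val_ne (by simp; omega) : j ≠ Fin.last (n + 1))
    induction j' using Fin.lastCases with
    | last =>
      right
      obtain rfl : j = Fin.last n := by
        apply Fin.ext
        simp at hj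
        simp [hj]
      rw [appendValue_last, hlast] at h
      cases b <;> simp only [adjacentBot, adjacentTop, if_true, Bool.false_eq_true, if_false] at h ⊢
        <;> split_ifs at h <;> omega
    | cast j' =>
      left
      refine ⟨i, j, j', hij, hj, ?_⟩
      cases b <;>
      · simp only [adjacentBot, adjacentTop, if_true, Bool.false_eq_true, if_false,
          val_appendValue_castSucc_lt_castSucc_iff] at h ⊢
        simpa only [val_appendValue_castSucc_lt_iff, ← not_lt] using h
  · rintro (⟨i, j, j', hij, hj, h⟩ | h)
    · refine ⟨i.castSucc, j.castSucc, j'.castSucc, hij, hj, ?_⟩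
      cases b <;>
      · simp only [adjacentBot, adjacentTop, if_true, Bool.false_eq_true, if_false,
          val_appendValue_castSucc_lt_castSucc_iff] at h ⊢
        simpa only [val_appendValue_castSucc_lt_iff, ← not_lt] using h
    · cases b
      · simp only [Bool.false_eq_true, if_false] at h
        obtain ⟨i, hi, hv⟩ :=
          exists_val_eq_of_ne_lastValue σ (v := lastValue σ + 1) (by omega) (by omega)
        refine ⟨i.castSucc, (Fin.last n).castSucc, Fin.last (n + 1), hi, by simp, ?_⟩
        rw [appendValue_last, hlast, val_appendValue_castSucc, hv]
        simp only [adjacentBot, adjacentTop, Bool.false_eq_true, if_false]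
        split_ifs <;> omega
      · simp only [if_true] at h
        obtain ⟨i, hi, hv⟩ := exists_val_eq_of_ne_lastValue σ (v := a) (by omega) (by omega)
        refine ⟨i.castSucc, (Fin.last n).castSucc, Fin.last (n + 1), hi, by simp, ?_⟩
        rw [appendValue_last, hlast, val_appendValue_castSucc, hv]
        simp only [adjacentBot, adjacentTop, if_true]
        split_ifs <;> omega

theorem not_blocked_lastValue_add_one {n : ℕ} (σ : Equiv.Perm (Fin (n + 1)))
    (hσ : ¬ HasPattern false σ) : ¬ Blocked false σ (lastValue σ + 1) := by
  rintro ⟨i, j, j', hij, hj, h1, h2, h3⟩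
  have hj' := j'.isLt
  simp only [adjacentBot, adjacentTop, Bool.false_eq_true, if_false] at h1 h3
  have hi : (σ i : ℕ) ≠ lastValue σ := fun h => by
    have : i = Fin.last n := σ.injective (Fin.ext h)
    simp [this] at hij
    omega
  have hjl : j' ≠ Fin.last n := by
    rintro rfl
    change lastValue σ + 1 ≤ lastValue σ at h3
    omega
  have hjn : (j' : ℕ) ≠ n := fun h => hjl (Fin.ext h)
  refine hσ ⟨i, j, j', Fin.last n, hij, hj, by simp; omega, ?_⟩
  change _ ∧ (σ i : ℕ) < lastValue σ ∧ lastValue σ < _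
  simp only [adjacentBot, adjacentTop, Bool.false_eq_true, if_false]
  omega

open Classical in
/-- The active sites not above the last value. -/
noncomputable def lowerSites (b : Bool) {n : ℕ} (σ : Equiv.Perm (Fin (n + 1))) : Finset ℕ :=
  {c ∈ Iic (lastValue σ) | ¬ Blocked b σ c}

open Classical in
/-- The active sites above the last value. -/
noncomputable def upperSites (b : Bool) {n : ℕ} (σ : Equiv.Perm (Fin (n + 1))) : Finset ℕ :=
  {c ∈ Ioc (lastValue σ) (n + 1) | ¬ Blocked b σ c}

theorem mem_lowerSites {b : Bool} {n : ℕ} {σ : Equiv.Perm (Fin (n + 1))} {c : ℕ} :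
    c ∈ lowerSites b σ ↔ c ≤ lastValue σ ∧ ¬ Blocked b σ c := by
  simp [lowerSites]

theorem mem_upperSites {b : Bool} {n : ℕ} {σ : Equiv.Perm (Fin (n + 1))} {c : ℕ} :
    c ∈ upperSites b σ ↔ (lastValue σ < c ∧ c ≤ n + 1) ∧ ¬ Blocked b σ c := by
  simp [upperSites]

theorem disjoint_lowerSites_upperSites (b : Bool) {n : ℕ} (σ : Equiv.Perm (Fin (n + 1))) :
    Disjoint (lowerSites b σ) (upperSites b σ) := by
  rw [Finset.disjoint_left]
  intro c h h'
  rw [mem_lowerSites] at h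
  rw [mem_upperSites] at h'
  omega

theorem parentSite_of_le {a c : ℕ} (h : c ≤ a) : parentSite a c = c := if_pos h

theorem parentSite_succ {a c : ℕ} (h : a ≤ c) : parentSite a (c + 1) = c := by
  rw [parentSite, if_neg (by omega)]; rfl

theorem mem_lowerSites_appendValue {b : Bool} {n : ℕ} {a : Fin (n + 2)}
    {σ : Equiv.Perm (Fin (n + 1))} {c : ℕ} :
    c ∈ lowerSites b (appendValue a σ) ↔
      c ≤ a ∧ ¬ Blocked b σ c ∧ (b = false → c ≤ lastValue σ + 1) := by
  rw [mem_lowerSites, lastValue_appendValue, blocked_appendValue_iff]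
  refine and_congr_right fun h => ?_
  rw [parentSite_of_le h, not_or]
  refine and_congr_right fun _ => ?_
  cases b <;> simp <;> omega

theorem add_one_mem_upperSites_appendValue {b : Bool} {n : ℕ} {a : Fin (n + 2)}
    {σ : Equiv.Perm (Fin (n + 1))} {c : ℕ} :
    c + 1 ∈ upperSites b (appendValue a σ) ↔
      (a ≤ c ∧ c ≤ n + 1) ∧ ¬ Blocked b σ c ∧ (b = true → c = a ∨ lastValue σ < c) := by
  rw [mem_upperSites, lastValue_appendValue, blocked_appendValue_iff]
  have : ((a : ℕ) < c + 1 ∧ c + 1 ≤ n + 1 + 1) ↔ (a : ℕ) ≤ c ∧ c ≤ n + 1 := by omega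
  rw [this]
  refine and_congr_right fun h => ?_
  rw [parentSite_succ h.1, not_or]
  refine and_congr_right fun _ => ?_
  cases b <;> simp <;> omega

theorem card_upperSites_appendValue_eq {b : Bool} {n : ℕ} {a : Fin (n + 2)}
    {σ : Equiv.Perm (Fin (n + 1))} {s : Finset ℕ}
    (hs : ∀ c, c ∈ s ↔
      (a ≤ c ∧ c ≤ n + 1) ∧ ¬ Blocked b σ c ∧ (b = true → c = a ∨ lastValue σ < c)) :
    #(upperSites b (appendValue a σ)) = #s := by
  rw [← card_map (addRightEmbedding 1) (s := s)]
  congr 1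
  ext c
  rw [mem_map]
  cases c with
  | zero => simp [mem_upperSites]
  | succ c => simp [add_one_mem_upperSites_appendValue, hs]

theorem card_lowerSites_appendValue_of_le {b : Bool} {n : ℕ} {a : Fin (n + 2)}
    {σ : Equiv.Perm (Fin (n + 1))} (h : a ≤ lastValue σ) :
    #(lowerSites b (appendValue a σ)) = #{c ∈ lowerSites b σ | c ≤ (a : ℕ)} := by
  congr 1
  ext c
  rw [mem_lowerSites_appendValue]
  simp only [mem_filter, mem_lowerSites]
  constructor
  · rintro ⟨h1, h2, -⟩
    exact ⟨⟨by omega, h2⟩, h1⟩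
  · rintro ⟨⟨h1, h2⟩, h3⟩
    exact ⟨h3, h2, fun _ => by omega⟩

theorem card_lowerSites_true_appendValue_of_lt {n : ℕ} {a : Fin (n + 2)}
    {σ : Equiv.Perm (Fin (n + 1))} (h : lastValue σ < a) :
    #(lowerSites true (appendValue a σ)) =
      #(lowerSites true σ) + #{c ∈ upperSites true σ | c ≤ (a : ℕ)} := by
  rw [← card_union_of_disjoint
    ((disjoint_lowerSites_upperSites true σ).mono_right (filter_subset _ _))]
  congr 1
  ext c
  have := a.isLt
  rw [mem_lowerSites_appendValue]
  simp only [mem_union, mem_filter, mem_lowerSites, mem_upperSites]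
  grind

theorem card_upperSites_true_appendValue_of_le {n : ℕ} {a : Fin (n + 2)}
    {σ : Equiv.Perm (Fin (n + 1))} (h : a ≤ lastValue σ) (ha : ¬ Blocked true σ a) :
    #(upperSites true (appendValue a σ)) = #(upperSites true σ) + 1 := by
  have hn : (a : ℕ) ∉ upperSites true σ := fun hm => by
    rw [mem_upperSites] at hm
    omega
  rw [← card_insert_of_notMem hn]
  apply card_upperSites_appendValue_eq
  intro c
  have := lastValue_le σ
  simp only [mem_insert, mem_upperSites]
  grind

theorem card_upperSites_appendValue_of_lt {b : Bool} {n : ℕ} {a : Fin (n + 2)}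
    {σ : Equiv.Perm (Fin (n + 1))} (h : lastValue σ < a) (ha : ¬ Blocked b σ a) :
    #(upperSites b (appendValue a σ)) = #{c ∈ upperSites b σ | (a : ℕ) < c} + 1 := by
  have hn : (a : ℕ) ∉ {c ∈ upperSites b σ | (a : ℕ) < c} := by simp
  rw [← card_insert_of_notMem hn]
  apply card_upperSites_appendValue_eq
  intro c
  have := a.isLt
  simp only [mem_insert, mem_filter, mem_upperSites]
  grind

theorem card_upperSites_false_appendValue_of_le {n : ℕ} {a : Fin (n + 2)}
    {σ : Equiv.Perm (Fin (n + 1))} (h : a ≤ lastValue σ) (ha : ¬ Blocked false σ a) :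
    #(upperSites false (appendValue a σ)) =
      #{c ∈ lowerSites false σ | (a : ℕ) < c} + #(upperSites false σ) + 1 := by
  rw [← card_union_of_disjoint
    ((disjoint_lowerSites_upperSites false σ).mono_left (filter_subset _ _))]
  have hn : (a : ℕ) ∉ {c ∈ lowerSites false σ | (a : ℕ) < c} ∪ upperSites false σ := by
    simp only [mem_union, mem_filter, mem_upperSites]
    omega
  rw [← card_insert_of_notMem hn]
  apply card_upperSites_appendValue_eq
  intro c
  have := lastValue_le σ
  simp only [mem_insert, mem_union, mem_filter, mem_lowerSites, mem_upperSites]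
  grind

theorem card_lowerSites_false_appendValue_of_lt {n : ℕ} {a : Fin (n + 2)}
    {σ : Equiv.Perm (Fin (n + 1))} (h : lastValue σ < a) (hσ : ¬ HasPattern false σ) :
    #(lowerSites false (appendValue a σ)) = #(lowerSites false σ) + 1 := by
  have hn : lastValue σ + 1 ∉ lowerSites false σ := fun hm => by
    rw [mem_lowerSites] at hm
    omega
  have := not_blocked_lastValue_add_one σ hσ
  rw [← card_insert_of_notMem hn]
  congr 1
  ext c
  rw [mem_lowerSites_appendValue]
  simp only [mem_insert, mem_lowerSites]
  grind

/-- Summing over a finite set a function of the rank of each element. -/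
theorem sum_card_filter_le {s : Finset ℕ} (G : ℕ → ℕ) :
    ∑ a ∈ s, G #{c ∈ s | c ≤ a} = ∑ i ∈ range #s, G (i + 1) := by
  induction s using Finset.induction_on_max with
  | empty => simp
  | insert x s hx ih =>
    have hxs : x ∉ s := fun h => lt_irrefl _ (hx x h)
    have hle : {c ∈ insert x s | c ≤ x} = insert x s :=
      filter_true_of_mem fun c hc => by
        rcases mem_insert.1 hc with rfl | hc
        · exact le_rfl
        · exact (hx c hc).le
    rw [sum_insert hxs, card_insert_of_notMem hxs, sum_range_succ, hle,
      card_insert_of_notMem hxs, add_comm, ← ih]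
    congr 1
    refine sum_congr rfl fun a ha => ?_
    rw [filter_insert, if_neg (by have := hx a ha; omega)]

theorem card_filter_lt_eq_sub (s : Finset ℕ) (a : ℕ) :
    #{c ∈ s | a < c} = #s - #{c ∈ s | c ≤ a} := by
  have := card_filter_add_card_filter_not (s := s) (fun c => c ≤ a)
  simp only [not_le] at this
  omega

/-- One step of the succession rule
`(h, k) ↦ (1, k+1), …, (h, k+1), (h+k, 1), …, (h+1, k)`, acting on statistics. -/
def successionSum (F : ℕ → ℕ → ℕ) (h k : ℕ) : ℕ :=
  ∑ i ∈ range h, F (i + 1) (k + 1) + ∑ j ∈ range k, F (h + (j + 1)) (k - (j + 1) + 1)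

theorem sum_active_true (F : ℕ → ℕ → ℕ) {n : ℕ} (σ : Equiv.Perm (Fin (n + 1)))
    (G : ℕ → ℕ)
    (hG : ∀ a : Fin (n + 2), G a =
      F #(lowerSites true (appendValue a σ)) #(upperSites true (appendValue a σ))) :
    ∑ a ∈ lowerSites true σ ∪ upperSites true σ, G a =
      successionSum F #(lowerSites true σ) #(upperSites true σ) := by
  rw [sum_union (disjoint_lowerSites_upperSites true σ), successionSum,
    ← sum_card_filter_le (fun i => F i (#(upperSites true σ) + 1)),
    ← sum_card_filter_le
      (fun j => F (#(lowerSites true σ) + j) (#(upperSites true σ) - j + 1))]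
  have hl := lastValue_le σ
  congr 1
  · refine sum_congr rfl fun a ha => ?_
    rw [mem_lowerSites] at ha
    lift a to Fin (n + 2) using by omega
    rw [hG, card_lowerSites_appendValue_of_le ha.1, card_upperSites_true_appendValue_of_le ha.1 ha.2]
  · refine sum_congr rfl fun a ha => ?_
    rw [mem_upperSites] at ha
    lift a to Fin (n + 2) using by omega
    rw [hG, card_lowerSites_true_appendValue_of_lt ha.1.1,
      card_upperSites_appendValue_of_lt ha.1.1 ha.2, card_filter_lt_eq_sub]

theorem sum_active_false (F : ℕ → ℕ → ℕ) {n : ℕ} (σ : Equiv.Perm (Fin (n + 1)))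
    (hσ : ¬ HasPattern false σ) (G : ℕ → ℕ)
    (hG : ∀ a : Fin (n + 2), G a =
      F #(upperSites false (appendValue a σ)) #(lowerSites false (appendValue a σ))) :
    ∑ a ∈ lowerSites false σ ∪ upperSites false σ, G a =
      successionSum F #(upperSites false σ) #(lowerSites false σ) := by
  have hl := lastValue_le σ
  rw [sum_union (disjoint_lowerSites_upperSites false σ), successionSum, add_comm,
    ← sum_range_reflect (fun i => F (i + 1) _),
    ← sum_range_reflect (fun j => F (_ + (j + 1)) _)]
  have h1 : ∑ a ∈ upperSites false σ, G a = ∑ a ∈ upperSites false σ,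
      F (#(upperSites false σ) - #{c ∈ upperSites false σ | c ≤ a} + 1)
        (#(lowerSites false σ) + 1) := by
    refine sum_congr rfl fun a ha => ?_
    rw [mem_upperSites] at ha
    lift a to Fin (n + 2) using by omega
    rw [hG, card_lowerSites_false_appendValue_of_lt ha.1.1 hσ,
      card_upperSites_appendValue_of_lt ha.1.1 ha.2, card_filter_lt_eq_sub]
  have h2 : ∑ a ∈ lowerSites false σ, G a = ∑ a ∈ lowerSites false σ,
      F (#(lowerSites false σ) - #{c ∈ lowerSites false σ | c ≤ a} + #(upperSites false σ) + 1)
        #{c ∈ lowerSites false σ | c ≤ a} := by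
    refine sum_congr rfl fun a ha => ?_
    rw [mem_lowerSites] at ha
    lift a to Fin (n + 2) using by omega
    rw [hG, card_lowerSites_appendValue_of_le ha.1,
      card_upperSites_false_appendValue_of_le ha.1 ha.2, card_filter_lt_eq_sub]
  rw [h1, h2, sum_card_filter_le (fun i => F (#(upperSites false σ) - i + 1) _),
    sum_card_filter_le (fun i => F (#(lowerSites false σ) - i + #(upperSites false σ) + 1) i)]
  congr 1 <;> refine sum_congr rfl fun i hi => ?_ <;> rw [mem_range] at hi <;> congr 1 <;> omega

open Classical in
theorem sum_avoiders_succ (b : Bool) (n : ℕ) (f : Equiv.Perm (Fin (n + 2)) → ℕ) :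
    ∑ τ with ¬ HasPattern b τ, f τ =
      ∑ σ : Equiv.Perm (Fin (n + 1)) with ¬ HasPattern b σ,
        ∑ a ∈ univ.filter fun a : Fin (n + 2) => ¬ Blocked b σ a, f (appendValue a σ) := by
  rw [sum_filter, sum_filter, ← (appendValue_bijective (n + 1)).sum_comp, Fintype.sum_prod_type,
    sum_comm]
  refine sum_congr rfl fun σ _ => ?_
  rw [sum_filter]
  by_cases h : HasPattern b σ <;> simp [hasPattern_appendValue_iff, h]

open Classical in
theorem sum_active_eq (b : Bool) {n : ℕ} (σ : Equiv.Perm (Fin (n + 1))) (g : Fin (n + 2) → ℕ) :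
    ∑ a ∈ univ.filter fun a : Fin (n + 2) => ¬ Blocked b σ a, g a =
      ∑ a ∈ lowerSites b σ ∪ upperSites b σ, if h : a < n + 2 then g ⟨a, h⟩ else 0 := by
  have hl := lastValue_le σ
  refine sum_bij (fun a _ => (a : ℕ)) ?_ ?_ ?_ ?_
  · intro a ha
    have := a.isLt
    simp only [mem_filter, mem_univ, true_and] at ha
    simp only [mem_union, mem_lowerSites, mem_upperSites, ha]
    grind
  · exact fun a _ a' _ h => Fin.ext h
  · intro a ha
    rw [mem_union, mem_lowerSites, mem_upperSites] at ha
    exact ⟨⟨a, by omega⟩, by simp; tauto, rfl⟩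
  · intro a _
    simp

open Classical in
theorem sum_avoiders_true_succ (n : ℕ) (F : ℕ → ℕ → ℕ) :
    ∑ τ : Equiv.Perm (Fin (n + 2)) with ¬ HasPattern true τ,
        F #(lowerSites true τ) #(upperSites true τ) =
      ∑ σ : Equiv.Perm (Fin (n + 1)) with ¬ HasPattern true σ,
        successionSum F #(lowerSites true σ) #(upperSites true σ) := by
  rw [sum_avoiders_succ]
  refine sum_congr rfl fun σ _ => ?_
  rw [sum_active_eq]
  exact sum_active_true F σ _ fun a => by simp

open Classical in
theorem sum_avoiders_false_succ (n : ℕ) (F : ℕ → ℕ → ℕ) :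
    ∑ τ : Equiv.Perm (Fin (n + 2)) with ¬ HasPattern false τ,
        F #(upperSites false τ) #(lowerSites false τ) =
      ∑ σ : Equiv.Perm (Fin (n + 1)) with ¬ HasPattern false σ,
        successionSum F #(upperSites false σ) #(lowerSites false σ) := by
  rw [sum_avoiders_succ]
  refine sum_congr rfl fun σ hσ => ?_
  rw [sum_active_eq]
  exact sum_active_false F σ (mem_filter.1 hσ).2 _ fun a => by simp

theorem not_blocked_of_perm_fin_one (b : Bool) (σ : Equiv.Perm (Fin 1)) (c : ℕ) :
    ¬ Blocked b σ c := by
  rintro ⟨i, j, j', hij, -⟩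
  omega

theorem card_lowerSites_of_perm_fin_one (b : Bool) (σ : Equiv.Perm (Fin 1)) :
    #(lowerSites b (n := 0) σ) = 1 := by
  simp [lowerSites, not_blocked_of_perm_fin_one, lastValue]

theorem card_upperSites_of_perm_fin_one (b : Bool) (σ : Equiv.Perm (Fin 1)) :
    #(upperSites b (n := 0) σ) = 1 := by
  simp [upperSites, not_blocked_of_perm_fin_one, lastValue]

theorem not_hasPattern_of_perm_fin_one (b : Bool) (σ : Equiv.Perm (Fin 1)) :
    ¬ HasPattern b σ := by
  rintro ⟨i, j, j', k, hij, -⟩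
  omega

open Classical in
/-- The two site statistics are equidistributed, up to exchange, over the avoiders of 2-41-3 and
of 2-14-3. -/
theorem sum_avoiders_true_eq_false (n : ℕ) (F : ℕ → ℕ → ℕ) :
    ∑ σ : Equiv.Perm (Fin (n + 1)) with ¬ HasPattern true σ,
        F #(lowerSites true σ) #(upperSites true σ) =
      ∑ σ : Equiv.Perm (Fin (n + 1)) with ¬ HasPattern false σ,
        F #(upperSites false σ) #(lowerSites false σ) := by
  induction n generalizing F with
  | zero =>
    simp [not_hasPattern_of_perm_fin_one, card_lowerSites_of_perm_fin_one,
      card_upperSites_of_perm_fin_one]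
  | succ n ih => rw [sum_avoiders_true_succ, sum_avoiders_false_succ, ih]

/-- Corollary 3.4: semi-Baxter permutations and plane permutations are equinumerous. -/
theorem semiBaxter_eq_plane_count (n : ℕ) (hn : 0 < n) :
    semiBaxterCount n = planeCount n := by
  classical
  obtain ⟨n, rfl⟩ := Nat.exists_eq_succ_of_ne_zero hn.ne'
  have h := sum_avoiders_true_eq_false n fun _ _ => 1
  simp only [← card_eq_sum_ones, hasPattern_true_iff, hasPattern_false_iff] at h
  simpa only [semiBaxterCount, planeCount, IsSemiBaxter, IsPlane, Nat.card_eq_fintype_card,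
    Fintype.card_subtype] using h
end

section
/- Let SB_n denote the number of semi-Baxter permutations of size n. Then SB_1 = 1, SB_2 = 2, and for all n ≥ 3, (n+4)(n+3)·SB_n = (11n²+11n−6)·SB_{n−1} + (n−3)(n−2)·SB_{n−2}. (Proposition 3.11.) -/
/-- Laurent polynomials over `ℚ` in two variables, written `a` and `w` below. -/
abbrev Laurent₂ : Type := AddMonoidAlgebra ℚ (ℤ × ℤ)

namespace Laurent₂
open AddMonoidAlgebra

/-- The monomial `a ^ i * w ^ j`. -/
noncomputable def mono (i j : ℤ) : Laurent₂ := single (i, j) 1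

theorem mono_mul (i j k l : ℤ) : mono i j * mono k l = mono (i + k) (j + l) := by
  simp [mono, single_mul_single]

theorem mono_zero : mono 0 0 = 1 := rfl

/-- The basis of monomials. -/
noncomputable def monoBasis : Module.Basis (ℤ × ℤ) ℚ Laurent₂ :=
  .ofRepr (coeffLinearEquiv ℚ)

theorem monoBasis_apply (e : ℤ × ℤ) : monoBasis e = mono e.1 e.2 := by
  ext; simp [monoBasis, mono, coeffLinearEquiv]

/-- The constant term of a Laurent polynomial. -/
noncomputable def CT : Laurent₂ →ₗ[ℚ] ℚ where
  toFun x := x.coeff (0, 0)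
  map_add' _ _ := by simp
  map_smul' _ _ := by simp

theorem CT_mono (i j : ℤ) : CT (mono i j) = if i = 0 ∧ j = 0 then 1 else 0 := by
  change (single (i, j) (1 : ℚ)).coeff (0, 0) = _
  rw [coeff_single, Finsupp.single_apply]
  simp

/-- The linear map multiplying each monomial `a ^ i * w ^ j` by `d (i, j)`. -/
noncomputable def eulerMap (d : ℤ × ℤ →+ ℚ) : Laurent₂ →ₗ[ℚ] Laurent₂ :=
  monoBasis.constr ℚ fun e => d e • mono e.1 e.2

theorem eulerMap_mono (d : ℤ × ℤ →+ ℚ) (i j : ℤ) :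
    eulerMap d (mono i j) = d (i, j) • mono i j := by
  have h := monoBasis.constr_basis ℚ (fun e => d e • mono e.1 e.2) (i, j)
  rwa [monoBasis_apply] at h

theorem induction {p : Laurent₂ → Prop} (add : ∀ x y, p x → p y → p (x + y))
    (smul : ∀ (c : ℚ) x, p x → p (c • x)) (mono : ∀ i j, p (mono i j)) (x : Laurent₂) : p x := by
  refine AddMonoidAlgebra.induction_linear x ?_ add ?_
  · simpa using smul 0 _ (mono 0 0)
  · intro e c
    have : single e c = c • Laurent₂.mono e.1 e.2 := by simp [Laurent₂.mono]
    rw [this]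
    exact smul _ _ (mono _ _)

theorem eulerMap_mul (d : ℤ × ℤ →+ ℚ) (x y : Laurent₂) :
    eulerMap d (x * y) = x * eulerMap d y + y * eulerMap d x := by
  induction x using induction with
  | add x₁ x₂ h₁ h₂ => simp only [add_mul, mul_add, map_add, h₁, h₂]; ring
  | smul c x h => simp only [smul_mul_assoc, mul_smul_comm, map_smul, h, smul_add]
  | mono i j =>
    induction y using induction with
    | add x₁ x₂ h₁ h₂ => simp only [add_mul, mul_add, map_add, h₁, h₂]; ring
    | smul c x h => simp only [smul_mul_assoc, mul_smul_comm, map_smul, h, smul_add]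
    | mono k l =>
      simp only [mono_mul, eulerMap_mono, mul_smul_comm, add_comm k i, add_comm l j, ← add_smul]
      rw [← map_add, Prod.mk_add_mk, add_comm k i, add_comm l j]

/-- The derivation multiplying each monomial `a ^ i * w ^ j` by `d (i, j)`. -/
noncomputable def euler (d : ℤ × ℤ →+ ℚ) : Derivation ℚ Laurent₂ Laurent₂ :=
  .mk' (eulerMap d) (eulerMap_mul d)

theorem euler_mono (d : ℤ × ℤ →+ ℚ) (i j : ℤ) : euler d (mono i j) = d (i, j) • mono i j :=
  eulerMap_mono d i j

theorem CT_euler (d : ℤ × ℤ →+ ℚ) (x : Laurent₂) : CT (euler d x) = 0 := by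
  induction x using induction with
  | add x₁ x₂ h₁ h₂ => simp [h₁, h₂]
  | smul c x h => simp [h]
  | mono i j =>
    rw [euler_mono, map_smul, CT_mono]
    split_ifs with h
    · rw [h.1, h.2]; simp [← Prod.zero_eq_mk]
    · simp

/-- The derivation `a ∂/∂a`. -/
noncomputable def θa : Derivation ℚ Laurent₂ Laurent₂ :=
  euler ((Int.castAddHom ℚ).comp (AddMonoidHom.fst ℤ ℤ))

/-- The derivation `w ∂/∂w`. -/
noncomputable def θw : Derivation ℚ Laurent₂ Laurent₂ :=
  euler ((Int.castAddHom ℚ).comp (AddMonoidHom.snd ℤ ℤ))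

theorem θa_mono (i j : ℤ) : θa (mono i j) = (i : ℚ) • mono i j := euler_mono _ i j
theorem θw_mono (i j : ℤ) : θw (mono i j) = (j : ℚ) • mono i j := euler_mono _ i j
theorem CT_θa (x : Laurent₂) : CT (θa x) = 0 := CT_euler _ x
theorem CT_θw (x : Laurent₂) : CT (θw x) = 0 := CT_euler _ x

/-- The first variable. -/
noncomputable def a : Laurent₂ := mono 1 0
/-- The inverse of the first variable. -/
noncomputable def a' : Laurent₂ := mono (-1) 0
/-- The second variable. -/
noncomputable def w : Laurent₂ := mono 0 1
/-- The inverse of the second variable. -/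
noncomputable def w' : Laurent₂ := mono 0 (-1)

theorem a_mul_inv : a * a' = 1 := by simp [a, a', mono_mul, mono_zero]
theorem w_mul_inv : w * w' = 1 := by simp [w, w', mono_mul, mono_zero]

theorem eq_of_eval {x x₂ : Laurent₂} (h : ∀ (K : Type) [Field K] (ι : Laurent₂ →+* K),
    ι a ≠ 0 → ι w ≠ 0 → ι a' = (ι a)⁻¹ → ι w' = (ι w)⁻¹ → ι x = ι x₂) : x = x₂ := by
  let ι := algebraMap Laurent₂ (FractionRing Laurent₂)
  have ha : ι a * ι a' = 1 := by rw [← map_mul, a_mul_inv, map_one]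
  have hw : ι w * ι w' = 1 := by rw [← map_mul, w_mul_inv, map_one]
  exact IsFractionRing.injective Laurent₂ (FractionRing Laurent₂) <|
    h _ ι (left_ne_zero_of_mul_eq_one ha) (left_ne_zero_of_mul_eq_one hw)
      (eq_inv_of_mul_eq_one_right ha) (eq_inv_of_mul_eq_one_right hw)

theorem θa_a : θa a = a := by simp [a, θa_mono]
theorem θa_a' : θa a' = -a' := by simp [a', θa_mono]
theorem θa_w : θa w = 0 := by simp [w, θa_mono]
theorem θa_w' : θa w' = 0 := by simp [w', θa_mono]
theorem θw_a : θw a = 0 := by simp [a, θw_mono]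
theorem θw_a' : θw a' = 0 := by simp [a', θw_mono]
theorem θw_w' : θw w' = -w' := by simp [w', θw_mono]
theorem θw_w : θw w = w := by simp [w, θw_mono]

/-- The polynomial by which the first label of the generating tree is marked. -/
noncomputable def y : Laurent₂ := 1 + a
/-- The polynomial by which the second label of the generating tree is marked. -/
noncomputable def z : Laurent₂ := 1 + a + w
/-- The sum of the two variables. -/
noncomputable def s : Laurent₂ := a + w
/-- The Laurent polynomial `y / (a w)`. -/
noncomputable def T : Laurent₂ := a' * w' * y

theorem θw_y : θw y = 0 := by simp [y, θw_a]
theorem θa_y : θa y = a := by simp [y, θa_a]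

/-- The Laurent polynomial `z (a + w) / w`. -/
noncomputable def p : Laurent₂ := w' * z * s

theorem p_eq : p = w + 1 + 2 * a + a * y * w' := by
  have := a_mul_inv; have := w_mul_inv
  unfold p s y z; grind

/-- The kernel `y z (1 / a + 1 / w)` of the generating tree. -/
noncomputable def P : Laurent₂ := y * z * (a' + w')

theorem P_eq_zsT : P = z * s * T := by
  have := a_mul_inv; have := w_mul_inv
  unfold P T s; grind

theorem P_eq_ypa : P = y * a' * p := by
  have := a_mul_inv; have := w_mul_inv
  unfold P p s; grind

theorem θw_p : θw p = w - a * y * w' := by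
  have h2 : θw 2 = 0 := θw.map_natCast 2
  simp [p_eq, θw_a, θw_w, θw_w', θw_y, h2, Derivation.leibniz]
  ring

/-- The rotation `w θa - a θw`, which annihilates `a + w`. -/
noncomputable def rot (x : Laurent₂) : Laurent₂ := w * θa x - a * θw x

theorem CT_rot (x : Laurent₂) : CT (rot x) = 0 := by
  have h : rot x = θa (w * x) - θw (a * x) := by
    simp [rot, Derivation.leibniz, θa_w, θw_a]
  rw [h, map_sub, CT_θa, CT_θw, sub_zero]

theorem rot_mul (x x₂ : Laurent₂) : rot (x * x₂) = x * rot x₂ + x₂ * rot x := by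
  simp only [rot, Derivation.leibniz, smul_eq_mul]; ring

theorem rot_pow_succ (x : Laurent₂) (n : ℕ) :
    rot (x ^ (n + 1)) = (n + 1 : ℚ) • (x ^ n * rot x) := by
  simp only [rot, Derivation.leibniz_pow, Nat.add_sub_cancel, smul_eq_mul, nsmul_eq_mul]
  simp only [Algebra.smul_def]
  push_cast [map_add, map_natCast, map_one]; ring

theorem rot_add (x x₂ : Laurent₂) : rot (x + x₂) = rot x + rot x₂ := by
  simp only [rot, map_add]; ring

theorem rot_pow_eq_zero {x : Laurent₂} (h : rot x = 0) (n : ℕ) : rot (x ^ n) = 0 := by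
  cases n with
  | zero => simp [rot]
  | succ n => simp [rot_pow_succ, h]

theorem rot_s : rot s = 0 := by
  simp [rot, s, θa_a, θa_w, θw_a, θw_w]; ring

theorem rot_z : rot z = 0 := by
  simp [rot, z, θa_a, θa_w, θw_a, θw_w]; ring

theorem rot_T : rot T = a' * w' * (a * y - w) := by
  have := a_mul_inv; have := w_mul_inv
  simp [rot, T, Derivation.leibniz, θa_y, θw_y, θa_a', θw_a', θa_w', θw_w']
  unfold y
  grind

theorem CT_T_pow_mul {q : Laurent₂} (hq : rot q = 0) (n : ℕ) :
    CT (T ^ n * (a' * w' * (a * y - w)) * q) = 0 := by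
  have h : rot (T ^ (n + 1) * q) =
      (n + 1 : ℚ) • (T ^ n * (a' * w' * (a * y - w)) * q) := by
    rw [rot_mul, hq, rot_pow_succ, rot_T, mul_smul_comm]
    simp [mul_comm]
  have h2 := CT_rot (T ^ (n + 1) * q)
  rw [h, map_smul, smul_eq_mul] at h2
  exact (mul_eq_zero.1 h2).resolve_left (by positivity)

theorem θw_p_pow_mul {q : Laurent₂} (hq : θw q = 0) (n : ℕ) :
    θw (p ^ (n + 1) * q) = (n + 1 : ℚ) • ((w - a * y * w') * p ^ n * q) := by
  simp only [Derivation.leibniz, Derivation.leibniz_pow, hq, θw_p, smul_eq_mul,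
    Nat.add_sub_cancel, nsmul_eq_mul]
  simp only [Algebra.smul_def]
  push_cast [map_add, map_natCast, map_one]; ring

theorem CT_p_pow_mul {q : Laurent₂} (hq : θw q = 0) (n : ℕ) :
    CT ((w - a * y * w') * p ^ n * q) = 0 := by
  have h2 := CT_θw (p ^ (n + 1) * q)
  rw [θw_p_pow_mul hq, map_smul, smul_eq_mul] at h2
  exact (mul_eq_zero.1 h2).resolve_left (by positivity)

/-- The initial Laurent polynomial of the constant term formula. -/
noncomputable def L : Laurent₂ :=
  z * s ^ 2 * w' * (w - a * y) * T * (z * (1 + 2 * s) - s ^ 3 * T) * (s - (s - 1) * T)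

theorem L_mul_z : L * z = (w - a * y * w') * w * y * p ^ 2 * (p - y * (2 + a)) *
    ((a ^ 2 - a) * p + 1) * a' ^ 3 := by
  apply eq_of_eval
  intro K _ ι ha hw ha' hw'
  simp only [L, T, p, s, z, y, map_add, map_sub, map_mul, map_pow, map_one, map_ofNat, ha', hw']
  field_simp
  ring

open Finset

theorem rot_sub (x x₂ : Laurent₂) : rot (x - x₂) = rot x - rot x₂ := by
  simp only [rot, map_sub]; ring

theorem rot_natCast (n : ℕ) : rot n = 0 := by simp [rot]

theorem CT_L_mul_z_pow (m k : ℕ) : CT (L * a' * P ^ m * z ^ (k + 1)) = 0 := by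
  have h2 : rot 2 = 0 := rot_natCast 2
  have h1 : rot 1 = 0 := by simpa using rot_natCast 1
  have e : L * a' * P ^ m * z ^ (k + 1) =
      -(T ^ (m + 1) * (a' * w' * (a * y - w)) *
        (z * s ^ 2 * (z * s) ^ m * z ^ (k + 1) * (z * (1 + 2 * s) * s)))
      + T ^ (m + 2) * (a' * w' * (a * y - w)) *
        (z * s ^ 2 * (z * s) ^ m * z ^ (k + 1) * (z * (1 + 2 * s) * (s - 1) + s ^ 3 * s))
      - T ^ (m + 3) * (a' * w' * (a * y - w)) *
        (z * s ^ 2 * (z * s) ^ m * z ^ (k + 1) * (s ^ 3 * (s - 1))) := by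
    rw [P_eq_zsT, L]; ring
  rw [e, map_sub, map_add, map_neg, CT_T_pow_mul, CT_T_pow_mul, CT_T_pow_mul]
  · simp
  all_goals
    simp only [rot_mul, rot_add, rot_sub, rot_pow_eq_zero rot_s, rot_pow_eq_zero rot_z, rot_s,
      rot_z, h1, h2, rot_pow_eq_zero (x := z * s) (by simp [rot_mul, rot_s, rot_z])]
    simp

theorem θw_two : θw 2 = 0 := θw.map_natCast 2

theorem CT_L_mul_y_pow (m n : ℕ) : CT (L * w' * z * y ^ n * P ^ m) = 0 := by
  have e : L * w' * z * y ^ n * P ^ m =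
      (w - a * y * w') * p ^ (m + 4) * (y * a' ^ 3 * y ^ n * (y * a') ^ m * (a ^ 2 - a))
      + (w - a * y * w') * p ^ (m + 3) *
        (y * a' ^ 3 * y ^ n * (y * a') ^ m * (1 - y * (2 + a) * (a ^ 2 - a)))
      - (w - a * y * w') * p ^ (m + 2) * (y * a' ^ 3 * y ^ n * (y * a') ^ m * (y * (2 + a))) := by
    calc _ = (L * z) * w' * y ^ n * P ^ m := by ring
      _ = (w * w') * ((w - a * y * w') * y * p ^ 2 * (p - y * (2 + a)) *
        ((a ^ 2 - a) * p + 1) * a' ^ 3) * y ^ n * P ^ m := by rw [L_mul_z]; ring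
      _ = _ := by rw [w_mul_inv, P_eq_ypa]; ring
  rw [e, map_sub, map_add, CT_p_pow_mul, CT_p_pow_mul, CT_p_pow_mul]
  · simp
  all_goals
    simp [Derivation.leibniz, Derivation.leibniz_pow, θw_y, θw_a, θw_a', θw_two]

theorem CT_w_mul {q : Laurent₂} (hq : θw q = 0) (n : ℕ) :
    2 * (n + 1) * CT ((w - a * y * w') * w * p ^ n * q) =
      -CT ((p - 1 - 2 * a) * p ^ (n + 1) * q) := by
  have h1 := CT_θw (w * (p ^ (n + 1) * q))
  rw [Derivation.leibniz, θw_w, θw_p_pow_mul hq] at h1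
  have h2 : w * (w - a * y * w') * p ^ n * q = (w - a * y * w') * w * p ^ n * q := by ring
  have h3 := CT_p_pow_mul hq (n + 1)
  have h4 : (p - 1 - 2 * a) * p ^ (n + 1) * q =
      (2 : ℚ) • (p ^ (n + 1) * q * w) - (w - a * y * w') * p ^ (n + 1) * q := by
    rw [show p - 1 - 2 * a = w + a * y * w' by rw [p_eq]; ring, Algebra.smul_def, map_ofNat]
    ring
  rw [h4, map_sub, h3, map_smul]
  have h5 : w • (n + 1 : ℚ) • ((w - a * y * w') * p ^ n * q) =
      (n + 1 : ℚ) • ((w - a * y * w') * w * p ^ n * q) := by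
    rw [smul_comm, smul_eq_mul, ← h2]; congr 1; ring
  rw [h5, map_add, map_smul, smul_eq_mul, smul_eq_mul] at h1
  rw [smul_eq_mul]
  linear_combination 2 * h1

theorem P_mul (h k : ℕ) : P * y ^ h * z ^ k =
    ∑ i ∈ range (h + 1), y ^ i * z ^ (k + 1) + ∑ j ∈ range k, y ^ (h + 1 + j) * z ^ (k - j)
      + a' * z ^ (k + 1) + w' * z * y ^ (h + k + 1) := by
  have g1 : (∑ i ∈ range (h + 1), y ^ i) * a = y ^ (h + 1) - 1 := by
    rw [← geom_sum_mul]; simp [y]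
  have g2 : (∑ j ∈ range k, y ^ j * z ^ (k - j)) * w = z * (z ^ k - y ^ k) := by
    have := geom_sum₂_mul y z k
    have e : ∑ j ∈ range k, y ^ j * z ^ (k - j) = z * ∑ j ∈ range k, y ^ j * z ^ (k - 1 - j) := by
      rw [mul_sum]
      refine sum_congr rfl fun j hj => ?_
      rw [mem_range] at hj
      rw [show k - j = k - 1 - j + 1 by omega]; ring
    rw [e, ← neg_sub (y ^ k), ← this]
    simp only [y, z]; ring
  have g3 : ∑ j ∈ range k, y ^ (h + 1 + j) * z ^ (k - j) =
      y ^ (h + 1) * ∑ j ∈ range k, y ^ j * z ^ (k - j) := by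
    rw [mul_sum]
    exact sum_congr rfl fun j _ => by ring
  rw [g3, ← sum_mul]
  have ha := a_mul_inv
  have hw := w_mul_inv
  unfold P
  linear_combination -a' * z ^ (k + 1) * g1 - w' * y ^ (h + 1) * g2
    + (∑ i ∈ range (h + 1), y ^ i) * z ^ (k + 1) * ha
    + y ^ (h + 1) * (∑ j ∈ range k, y ^ j * z ^ (k - j)) * hw

theorem CT_step (m h k : ℕ) : CT (L * P ^ (m + 1) * y ^ h * z ^ k) =
    ∑ i ∈ range (h + 1), CT (L * P ^ m * y ^ i * z ^ (k + 1)) +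
      ∑ j ∈ range k, CT (L * P ^ m * y ^ (h + 1 + j) * z ^ (k - j)) := by
  have e : L * P ^ (m + 1) * y ^ h * z ^ k =
      ∑ i ∈ range (h + 1), L * P ^ m * y ^ i * z ^ (k + 1) +
      ∑ j ∈ range k, L * P ^ m * y ^ (h + 1 + j) * z ^ (k - j)
      + L * a' * P ^ m * z ^ (k + 1) + L * w' * z * y ^ (h + k + 1) * P ^ m := by
    calc _ = L * P ^ m * (P * y ^ h * z ^ k) := by ring
      _ = _ := by
        rw [P_mul, mul_add, mul_add, mul_add, mul_sum, mul_sum]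
        ring_nf
  rw [e, map_add, map_add, CT_L_mul_z_pow, CT_L_mul_y_pow, add_zero, add_zero, map_add,
    map_sum, map_sum]

/-- The span of the monomials having at least one positive exponent. -/
noncomputable def posPart : Submodule ℚ Laurent₂ :=
  Submodule.span ℚ {x | ∃ i j : ℤ, (0 < i ∨ 0 < j) ∧ mono i j = x}

theorem mono_mem_posPart {i j : ℤ} (h : 0 < i ∨ 0 < j) : mono i j ∈ posPart :=
  Submodule.subset_span ⟨i, j, h, rfl⟩

theorem CT_of_mem_posPart {x : Laurent₂} (hx : x ∈ posPart) : CT x = 0 := by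
  induction hx using Submodule.span_induction with
  | mem x hx =>
    obtain ⟨i, j, h, rfl⟩ := hx
    rw [CT_mono, if_neg (by omega)]
  | zero => simp
  | add x x₂ _ _ h h₂ => simp [h, h₂]
  | smul c x _ h => simp [h]

theorem mono_mul_mem_posPart {i j : ℤ} (hi : 0 ≤ i) (hj : 0 ≤ j) {x : Laurent₂}
    (hx : x ∈ posPart) : mono i j * x ∈ posPart := by
  induction hx using Submodule.span_induction with
  | mem x hx =>
    obtain ⟨k, l, h, rfl⟩ := hx
    rw [mono_mul]
    exact mono_mem_posPart (by omega)
  | zero => simp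
  | add x x₂ _ _ h h₂ => rw [mul_add]; exact add_mem h h₂
  | smul c x _ h => rw [mul_smul_comm]; exact posPart.smul_mem c h

/-- The polynomials, inside the Laurent polynomials. -/
noncomputable def polys : Subalgebra ℚ Laurent₂ := Algebra.adjoin ℚ {a, w}

theorem a_mem_polys : a ∈ polys := Algebra.subset_adjoin (by simp)
theorem w_mem_polys : w ∈ polys := Algebra.subset_adjoin (by simp)

theorem mul_mem_posPart {q : Laurent₂} (hq : q ∈ polys) :
    ∀ {x : Laurent₂}, x ∈ posPart → q * x ∈ posPart := by
  induction hq using Algebra.adjoin_induction with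
  | mem q hq =>
    rcases hq with rfl | rfl
    · exact mono_mul_mem_posPart (by norm_num) (by norm_num)
    · exact mono_mul_mem_posPart (by norm_num) (by norm_num)
  | algebraMap r =>
    intro x hx
    rw [← Algebra.smul_def]
    exact posPart.smul_mem r hx
  | add q q₂ _ _ h h₂ => intro x hx; rw [add_mul]; exact add_mem (h hx) (h₂ hx)
  | mul q q₂ _ _ h h₂ => intro x hx; rw [mul_assoc]; exact h (h₂ hx)

theorem L_eq : ∃ q ∈ polys, ∃ q₂ ∈ polys,
    L = a' ^ 2 + a' * w' + 3 * a' - w' ^ 2 + w' + 2 + q * (a * w' ^ 4) + q₂ * (a' ^ 3 * w) := by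
  refine ⟨6 * w ^ 7 - w - 5 * w ^ 2 - 2 * w ^ 3 - 2 * w ^ 6 + 4 * w ^ 8 - 2 * a * w - 4 * a * w ^ 2
      + 4 * a * w ^ 6 + 3 * a * w ^ 7 - a * w ^ 8 + a ^ 2 + 4 * a ^ 2 * w + 6 * a ^ 2 * w ^ 2 - 6
      * a ^ 2 * w ^ 6 - 5 * a ^ 2 * w ^ 7 + 4 * a ^ 3 + 11 * a ^ 3 * w - 6 * a ^ 3 * w ^ 3 + 6
      * a ^ 3 * w ^ 4 - 6 * a ^ 3 * w ^ 5 - 9 * a ^ 3 * w ^ 6 + 5 * a ^ 4 - 17 * a ^ 4 * w ^ 2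
      + 6 * a ^ 4 * w ^ 3 + 11 * a ^ 4 * w ^ 4 - 5 * a ^ 4 * w ^ 5 - 16 * a ^ 5 * w - 8 * a ^ 5
      * w ^ 2 + 19 * a ^ 5 * w ^ 3 + 5 * a ^ 5 * w ^ 4 - 5 * a ^ 6 - 12 * a ^ 6 * w + 8 * a ^ 6
      * w ^ 2 + 9 * a ^ 6 * w ^ 3 - 4 * a ^ 7 - a ^ 7 * w + 5 * a ^ 7 * w ^ 2 - a ^ 8 + a ^ 8 *
      w, ?_,
    w ^ 3 - w - a - 2 * a * w + 3 * a * w ^ 2 - a * w ^ 4 - 2 * a ^ 2 + 2 * a ^ 2 * w - 4 * a ^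
      2 * w ^ 3 - 5 * a ^ 3 * w ^ 2 + 2 * a ^ 3 * w ^ 3 + a ^ 3 * w ^ 4, ?_, ?_⟩
  · with_reducible repeat' first
      | exact a_mem_polys
      | exact w_mem_polys
      | exact ofNat_mem _ _
      | apply add_mem
      | apply sub_mem
      | apply mul_mem
      | apply pow_mem
  · with_reducible repeat' first
      | exact a_mem_polys
      | exact w_mem_polys
      | exact ofNat_mem _ _
      | apply add_mem
      | apply sub_mem
      | apply mul_mem
      | apply pow_mem
  · apply eq_of_eval
    intro K _ ι ha hw ha' hw'
    simp only [L, T, s, z, y, map_add, map_sub, map_mul, map_pow, map_one, map_ofNat, ha', hw']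
    field_simp
    ring

theorem L_sub_mem_posPart :
    L - (a' ^ 2 + a' * w' + 3 * a' - w' ^ 2 + w' + 2) ∈ posPart := by
  obtain ⟨q, hq, q₂, hq₂, h⟩ := L_eq
  rw [h, show ∀ u v t : Laurent₂, u + v + t - u = v + t from fun u v t => by ring]
  refine add_mem (mul_mem_posPart hq ?_) (mul_mem_posPart hq₂ ?_)
  · simpa [a, w', pow_succ, mono_mul] using mono_mem_posPart (i := 1) (j := -4) (by norm_num)
  · simpa [a', w, pow_succ, mono_mul] using mono_mem_posPart (i := -3) (j := 1) (by norm_num)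

theorem y_mem_polys : y ∈ polys := add_mem (one_mem _) a_mem_polys
theorem z_mem_polys : z ∈ polys := add_mem y_mem_polys w_mem_polys

theorem smul_mono_mem_posPart {i j : ℤ} (h : 0 < i ∨ 0 < j) (c : ℚ) : c • mono i j ∈ posPart :=
  posPart.smul_mem c (mono_mem_posPart h)

/-- The Laurent polynomials arising as the nonpositive parts of `L * y ^ h * z ^ k`. -/
noncomputable def lowPart (c₁ c₂ c₃ : ℚ) : Laurent₂ :=
  a' ^ 2 + a' * w' - w' ^ 2 + c₁ • a' + c₂ • w' + c₃ • 1

theorem y_mul_lowPart (c₁ c₂ c₃ : ℚ) :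
    y * lowPart c₁ c₂ c₃ - lowPart (c₁ + 1) (c₂ + 1) (c₃ + c₁) ∈ posPart := by
  have e : y * lowPart c₁ c₂ c₃ - lowPart (c₁ + 1) (c₂ + 1) (c₃ + c₁) =
      (-1 : ℚ) • mono 1 (-2) + c₂ • mono 1 (-1) + c₃ • mono 1 0 := by
    have e₁ : mono 1 (-2) = a * w' ^ 2 := by simp [a, w', pow_two, mono_mul]
    have e₂ : mono 1 (-1) = a * w' := by simp [a, w', mono_mul]
    have e₃ : mono 1 0 = a := rfl
    rw [e₁, e₂, e₃]
    simp only [lowPart, y, Algebra.smul_def, map_add, map_one, map_neg]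
    linear_combination (algebraMap ℚ Laurent₂ c₁ + a' + w') * a_mul_inv
  rw [e]
  exact add_mem (add_mem (smul_mono_mem_posPart (by simp) _)
    (smul_mono_mem_posPart (by simp) _)) (smul_mono_mem_posPart (by simp) _)

theorem z_mul_lowPart (c₁ c₂ c₃ : ℚ) :
    z * lowPart c₁ c₂ c₃ - lowPart (c₁ + 2) c₂ (c₃ + c₁ + c₂) ∈ posPart := by
  have e : z * lowPart c₁ c₂ c₃ - lowPart (c₁ + 2) c₂ (c₃ + c₁ + c₂) =
      y * lowPart c₁ c₂ c₃ - lowPart (c₁ + 1) (c₂ + 1) (c₃ + c₁) +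
      ((1 : ℚ) • mono (-2) 1 + c₁ • mono (-1) 1 + c₃ • mono 0 1) := by
    have e₁ : mono (-2) 1 = a' ^ 2 * w := by simp [a', w, pow_two, mono_mul]
    have e₂ : mono (-1) 1 = a' * w := by simp [a', w, mono_mul]
    have e₃ : mono 0 1 = w := rfl
    rw [e₁, e₂, e₃]
    simp only [lowPart, y, z, Algebra.smul_def, map_add, map_one, map_ofNat]
    linear_combination (algebraMap ℚ Laurent₂ c₂ + a' - w') * w_mul_inv
  rw [e]
  exact add_mem (y_mul_lowPart _ _ _) <| add_mem (add_mem (smul_mono_mem_posPart (by simp) _)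
    (smul_mono_mem_posPart (by simp) _)) (smul_mono_mem_posPart (by simp) _)

/-- The constant terms of `L * y ^ h * z ^ k`. -/
def lowConst (h k : ℕ) : ℚ :=
  (h + 1) * (h + 2) / 2 + (h + 1) * (k + 1) + k * (h + k + 2)

theorem L_mul_sub_lowPart_mem (h k : ℕ) :
    L * y ^ h * z ^ k - lowPart (h + 2 * k + 3) (h + 1) (lowConst h k) ∈ posPart := by
  induction k with
  | zero =>
    induction h with
    | zero =>
      convert L_sub_mem_posPart using 1
      rw [show lowConst 0 0 = 2 by norm_num [lowConst]]
      simp only [lowPart, Algebra.smul_def, Nat.cast_zero, zero_add, mul_zero, map_one, map_ofNat]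
      ring
    | succ h ih =>
      have h₁ := add_mem (mul_mem_posPart y_mem_polys ih) (y_mul_lowPart (h + 2 * (0 : ℕ) + 3)
        (h + 1) (lowConst h 0))
      convert h₁ using 1
      rw [show lowConst (h + 1) 0 = lowConst h 0 + (h + 2 * (0 : ℕ) + 3) by
        simp only [lowConst]; push_cast; ring]
      rw [mul_sub, sub_add_sub_cancel, pow_succ]
      congr 1
      · ring
      · congr 1 <;> push_cast <;> ring
  | succ k ih =>
    have h₁ := add_mem (mul_mem_posPart z_mem_polys ih) (z_mul_lowPart (h + 2 * k + 3)
      (h + 1) (lowConst h k))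
    convert h₁ using 1
    rw [show lowConst h (k + 1) = lowConst h k + (h + 2 * k + 3) + (h + 1) by
      simp only [lowConst]; push_cast; ring]
    rw [mul_sub, sub_add_sub_cancel, pow_succ]
    congr 1
    · ring
    · congr 1; push_cast; ring

theorem CT_lowPart (c₁ c₂ c₃ : ℚ) : CT (lowPart c₁ c₂ c₃) = c₃ := by
  simp [lowPart, a', w', pow_two, mono_mul, ← mono_zero, CT_mono]

theorem CT_L (h k : ℕ) : CT (L * y ^ h * z ^ k) = lowConst h k := by
  have h₁ := CT_of_mem_posPart (L_mul_sub_lowPart_mem h k)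
  rwa [map_sub, sub_eq_zero, CT_lowPart] at h₁

/-- The number of nodes at depth `m` in the generating tree with succession rule
`(h, k) ↦ (1, k + 1), …, (h, k + 1), (h + k, 1), …, (h + 1, k)` and root `(h, k)`. -/
def treeCount : ℕ → ℕ → ℕ → ℕ
  | 0, _, _ => 1
  | m + 1, h, k => ∑ i ∈ range h, treeCount m (i + 1) (k + 1) +
      ∑ j ∈ range k, treeCount m (h + j + 1) (k - j)

theorem treeCount_one (h k : ℕ) : treeCount 1 h k = h + k := by simp [treeCount]

theorem treeCount_two (h k : ℕ) : (treeCount 2 (h + 1) k : ℚ) = lowConst h k := by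
  have h₁ : ∀ n : ℕ, ∑ i ∈ range n, (i : ℚ) = n * (n - 1) / 2 := fun n => by
    induction n with
    | zero => simp
    | succ n ih => rw [sum_range_succ, ih]; push_cast; ring
  have h₂ : ∑ j ∈ range k, treeCount 1 (h + 1 + j + 1) (k - j) = k * (h + k + 2) := by
    rw [sum_const_nat (m := h + k + 2), card_range]
    intro j hj
    rw [mem_range] at hj
    rw [treeCount_one]; omega
  rw [treeCount, h₂]
  simp only [treeCount_one, lowConst, Nat.cast_add, Nat.cast_sum, sum_add_distrib, h₁]
  simp
  ring

theorem treeCount_eq_CT (m h k : ℕ) :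
    (treeCount (m + 2) (h + 1) k : ℚ) = CT (L * P ^ m * y ^ h * z ^ k) := by
  induction m generalizing h k with
  | zero => rw [treeCount_two, pow_zero, mul_one, CT_L]
  | succ m ih =>
    rw [treeCount, CT_step]
    push_cast
    simp only [ih]

/-- The constant terms `b m i j` of `a ^ i * p ^ j * P ^ m`. -/
noncomputable def b (m : ℕ) (i : ℤ) (j : ℕ) : ℚ := CT (mono (i - m) 0 * y ^ m * p ^ (m + j))

theorem mono_add_one (i : ℤ) : mono (i + 1) 0 = mono i 0 * a := by
  simp [a, mono_mul]

theorem b_add_one (m : ℕ) (i : ℤ) (j : ℕ) :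
    b m (i + 1) j = CT (mono (i - m) 0 * a * y ^ m * p ^ (m + j)) := by
  rw [b, ← mono_add_one, sub_add_eq_add_sub]

theorem b_succ_left (m : ℕ) (i : ℤ) (j : ℕ) :
    b (m + 1) i j = b m (i - 1) (j + 1) + b m i (j + 1) := by
  have h := b_add_one m (i - 1) (j + 1)
  rw [sub_add_cancel] at h
  rw [h, b, b, ← map_add]
  congr 1
  rw [show (i - (m + 1 : ℕ) : ℤ) = i - 1 - m by push_cast; ring]
  unfold y
  ring

theorem θw_mono_zero (i : ℤ) : θw (mono i 0) = 0 := by simp [θw_mono]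

theorem y_mul_θa_p : 2 * y * θa p + (1 + 2 * a) * θw p = (1 + 2 * a) * p - 1 := by
  have h2 : θa 2 = 0 := θa.map_natCast 2
  have h : θa p = 2 * a + a * (1 + 2 * a) * w' := by
    simp [p_eq, θa_a, θa_w, θa_w', θa_y, h2, Derivation.leibniz]
    unfold y
    ring
  rw [h, θw_p, p_eq]
  unfold y
  ring

theorem b_rel_θa (m : ℕ) (i : ℤ) (j : ℕ) :
    i * (b m i (j + 1) + b m (i + 1) (j + 1)) - m * b m i (j + 1) + b m (i + 1) (j + 1) +
      (m + j + 1) / 2 * (b m i (j + 1) + 2 * b m (i + 1) (j + 1) - b m i j) = 0 := by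
  have hy : y = 1 + a := rfl
  have h₁ := CT_θa (mono (i - m) 0 * y ^ (m + 1) * p ^ (m + j + 1))
  have h₂ := CT_θw (mono (i - m) 0 * y ^ m * (1 + 2 * a) * p ^ (m + j + 1))
  have hw : θw (mono (i - m) 0 * y ^ m * (1 + 2 * a)) = 0 := by
    simp [Derivation.leibniz, Derivation.leibniz_pow, θw_y, θw_mono_zero, θw_two, θw_a]
  have e : (2 : ℚ) • θa (mono (i - m) 0 * y ^ (m + 1) * p ^ (m + j + 1)) +
      θw (mono (i - m) 0 * y ^ m * (1 + 2 * a) * p ^ (m + j + 1)) =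
      (2 * (i - m) : ℚ) • (mono (i - m) 0 * y ^ m * p ^ (m + (j + 1)))
      + (2 * (i - m) : ℚ) • (mono (i - m) 0 * a * y ^ m * p ^ (m + (j + 1)))
      + (2 * (m + 1) : ℚ) • (mono (i - m) 0 * a * y ^ m * p ^ (m + (j + 1)))
      + (m + j + 1 : ℚ) • (mono (i - m) 0 * y ^ m * p ^ (m + (j + 1)))
      + (2 * (m + j + 1) : ℚ) • (mono (i - m) 0 * a * y ^ m * p ^ (m + (j + 1)))
      - (m + j + 1 : ℚ) • (mono (i - m) 0 * y ^ m * p ^ (m + j)) := by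
    rw [Derivation.leibniz, Derivation.leibniz, Derivation.leibniz_pow, Derivation.leibniz_pow,
      θa_mono, θa_y, Derivation.leibniz _ (_ * _), hw, Derivation.leibniz_pow]
    simp only [smul_eq_mul, nsmul_eq_mul, Nat.add_sub_cancel]
    simp only [Algebra.smul_def]
    push_cast [map_add, map_sub, map_mul, map_natCast, map_intCast, map_one, map_ofNat]
    linear_combination (m + j + 1 : Laurent₂) * mono (i - m) 0 * y ^ m * p ^ (m + j) * y_mul_θa_p
      + 2 * (i - m : Laurent₂) * mono (i - m) 0 * y ^ m * p ^ (m + (j + 1)) *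
        hy
  have h := congrArg CT e
  rw [map_add, map_smul, h₁, h₂] at h
  simp only [map_add, map_sub, map_smul, smul_eq_mul, ← b_add_one] at h
  simp only [b] at h ⊢
  linear_combination -h / 2

theorem b_rel_θw (m : ℕ) (i : ℤ) (j : ℕ) :
    (m + j + 1) * (b m i (j + 2) - 2 * b m i (j + 1) - 4 * b m (i + 1) (j + 1) + b m i j) +
      b m i (j + 2) - b m i (j + 1) - 2 * b m (i + 1) (j + 1) = 0 := by
  have hy : y = 1 + a := rfl
  have h₁ := CT_θw ((w - a * y * w') * (p ^ (m + j + 1) * (mono (i - m) 0 * y ^ m)))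
  have e : θw ((w - a * y * w') * (p ^ (m + j + 1) * (mono (i - m) 0 * y ^ m))) =
      (m + j + 1 : ℚ) • (mono (i - m) 0 * y ^ m * p ^ (m + (j + 2)))
      - (2 * (m + j + 1) : ℚ) • (mono (i - m) 0 * y ^ m * p ^ (m + (j + 1)))
      - (4 * (m + j + 1) : ℚ) • (mono (i - m) 0 * a * y ^ m * p ^ (m + (j + 1)))
      + (m + j + 1 : ℚ) • (mono (i - m) 0 * y ^ m * p ^ (m + j))
      + mono (i - m) 0 * y ^ m * p ^ (m + (j + 2))
      - mono (i - m) 0 * y ^ m * p ^ (m + (j + 1))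
      - (2 : ℚ) • (mono (i - m) 0 * a * y ^ m * p ^ (m + (j + 1))) := by
    have h : θw (w - a * y * w') = w + a * y * w' := by
      simp [Derivation.leibniz, θw_a, θw_w, θw_w', θw_y]
    have hq : θw (mono (i - m) 0 * y ^ m) = 0 := by
      simp [Derivation.leibniz, Derivation.leibniz_pow, θw_y, θw_mono_zero]
    have h₃ : w + a * y * w' = p - 1 - 2 * a := by rw [p_eq]; ring
    have h₄ : (w - a * y * w') ^ 2 = (w + a * y * w') ^ 2 - 4 * a * y := by
      linear_combination (-4 * a * y) * w_mul_inv
    have hn := θw_p_pow_mul hq (m + j)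
    rw [Derivation.leibniz, h, hn, h₃]
    rw [h₃] at h₄
    simp only [smul_eq_mul, Algebra.smul_def]
    push_cast [map_add, map_sub, map_mul, map_natCast, map_intCast, map_one, map_ofNat]
    linear_combination (m + j + 1 : Laurent₂) * mono (i - m) 0 * y ^ m * p ^ (m + j) * (h₄ -
      4 * a * hy)
  rw [e] at h₁
  simp only [map_add, map_sub, map_smul, smul_eq_mul, ← b_add_one] at h₁
  simp only [b] at h₁ ⊢
  linear_combination h₁

theorem mono_sub_natCast (i : ℤ) (m : ℕ) : mono (i - m) 0 = mono i 0 * a' ^ m := by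
  induction m with
  | zero => simp
  | succ m ih =>
    rw [pow_succ, ← mul_assoc, ← ih, a', mono_mul]
    congr 1
    push_cast
    ring

/-- The constant term of `(p - 1 - 2 * a) * a ^ i * p ^ j * P ^ m`. -/
noncomputable def d (m : ℕ) (i : ℤ) (j : ℕ) : ℚ := b m i (j + 1) - b m i j - 2 * b m (i + 1) j

theorem CT_eq_d (m : ℕ) (i : ℤ) (j : ℕ) :
    CT ((p - 1 - 2 * a) * p ^ (m + j) * (mono (i - m) 0 * y ^ m)) = d m i j := by
  rw [d, b_add_one, b, b, ← map_sub, ← smul_eq_mul (2 : ℚ), ← map_smul, ← map_sub,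
    Algebra.smul_def, map_ofNat]
  congr 1
  ring

theorem treeCount_eq_sum_d (m : ℕ) : 2 * (treeCount (m + 2) 1 1 : ℚ) =
    -((d m 0 5 - d m (-2) 5) / (m + 5) +
      (d m (-3) 4 + 3 * d m (-2) 4 + 3 * d m (-1) 4 - d m 0 4 - 3 * d m 1 4 - d m 2 4) / (m + 4) -
      (2 * d m (-3) 3 + 5 * d m (-2) 3 + 4 * d m (-1) 3 + d m 0 3) / (m + 3)) := by
  rw [treeCount_eq_CT m 0 1]
  have hm : ∀ i : ℤ, θw (mono (i - m) 0 * y ^ m) = 0 := fun i => by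
    simp [Derivation.leibniz, Derivation.leibniz_pow, θw_y, θw_mono_zero]
  have key : ∀ (n : ℕ) (i : ℤ), CT ((w - a * y * w') * w * p ^ (m + n) * (mono (i - m) 0 * y ^ m)) =
      -d m i (n + 1) / (2 * (m + n + 1)) := fun n i => by
    have h := CT_w_mul (hm i) (m + n)
    rw [add_assoc m n, CT_eq_d] at h
    push_cast at h
    rw [eq_div_iff (by positivity), ← h]
    ring
  have e : L * P ^ m * y ^ 0 * z ^ 1 =
      (w - a * y * w') * w * p ^ (m + 4) * (mono (0 - m) 0 * y ^ m)
      - (w - a * y * w') * w * p ^ (m + 4) * (mono (-2 - m) 0 * y ^ m)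
      + (w - a * y * w') * w * p ^ (m + 3) * (mono (-3 - m) 0 * y ^ m)
      + (3 : ℚ) • ((w - a * y * w') * w * p ^ (m + 3) * (mono (-2 - m) 0 * y ^ m))
      + (3 : ℚ) • ((w - a * y * w') * w * p ^ (m + 3) * (mono (-1 - m) 0 * y ^ m))
      - (w - a * y * w') * w * p ^ (m + 3) * (mono (0 - m) 0 * y ^ m)
      - (3 : ℚ) • ((w - a * y * w') * w * p ^ (m + 3) * (mono (1 - m) 0 * y ^ m))
      - (w - a * y * w') * w * p ^ (m + 3) * (mono (2 - m) 0 * y ^ m)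
      - (2 : ℚ) • ((w - a * y * w') * w * p ^ (m + 2) * (mono (-3 - m) 0 * y ^ m))
      - (5 : ℚ) • ((w - a * y * w') * w * p ^ (m + 2) * (mono (-2 - m) 0 * y ^ m))
      - (4 : ℚ) • ((w - a * y * w') * w * p ^ (m + 2) * (mono (-1 - m) 0 * y ^ m))
      - (w - a * y * w') * w * p ^ (m + 2) * (mono (0 - m) 0 * y ^ m) := by
    have h₀ : (p - y * (2 + a)) * ((a ^ 2 - a) * p + 1) * y * a' ^ 3 =
        p ^ 2 * (1 - a' ^ 2) + p * (a' ^ 3 + 3 * a' ^ 2 + 3 * a' - 1 - 3 * a - a ^ 2)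
        - (2 * a' ^ 3 + 5 * a' ^ 2 + 4 * a' + 1) := by
      apply eq_of_eval
      intro K _ ι ha hw ha' hw'
      simp only [y, map_add, map_sub, map_mul, map_pow, map_one, map_ofNat, ha']
      field_simp
      ring
    have e₃ : mono (-3) 0 = a' ^ 3 := by simp [a', pow_succ, mono_mul]
    have e₂ : mono (-2) 0 = a' ^ 2 := by simp [a', pow_succ, mono_mul]
    have e₁ : mono (-1) 0 = a' := rfl
    have f₁ : mono 1 0 = a := rfl
    have f₂ : mono 2 0 = a ^ 2 := by simp [a, pow_succ, mono_mul]
    simp only [mono_sub_natCast, e₁, e₂, e₃, f₁, f₂, mono_zero, Algebra.smul_def, map_ofNat]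
    calc _ = (L * z) * P ^ m := by ring
      _ = (w - a * y * w') * w * p ^ 2 * ((p - y * (2 + a)) * ((a ^ 2 - a) * p + 1) * y * a' ^ 3) *
          (y * a' * p) ^ m := by rw [L_mul_z, P_eq_ypa]; ring
      _ = _ := by rw [h₀]; ring
  rw [e]
  simp only [map_add, map_sub, map_smul, key, smul_eq_mul]
  norm_num
  field_simp
  ring

theorem treeCount_eq_b (m : ℕ) :
    (m + 3) * (m + 4) ^ 2 * (m + 5) * (m + 6) ^ 2 * (m + 7) * (treeCount (m + 2) 1 1 : ℚ) =
      12 * (m ^ 2 + 13 * m + 32) * b m (-3) 4 + 12 * (5 * m ^ 2 + 31 * m + 46) * b m (-3) 5 := by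
  have hS := treeCount_eq_sum_d m
  simp only [d] at hS
  have wn3_4 := b_rel_θw m (-3) 3
  have wn2_4 := b_rel_θw m (-2) 3
  have wn2_5 := b_rel_θw m (-2) 4
  have wn1_4 := b_rel_θw m (-1) 3
  have w0_4 := b_rel_θw m 0 3
  have w0_5 := b_rel_θw m 0 4
  have w1_4 := b_rel_θw m 1 3
  have w2_4 := b_rel_θw m 2 3
  have an3_4 := b_rel_θa m (-3) 3
  have an3_5 := b_rel_θa m (-3) 4
  have an2_4 := b_rel_θa m (-2) 3
  have an2_5 := b_rel_θa m (-2) 4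
  have an1_4 := b_rel_θa m (-1) 3
  have an1_5 := b_rel_θa m (-1) 4
  have a0_4 := b_rel_θa m 0 3
  have a0_5 := b_rel_θa m 0 4
  have a1_4 := b_rel_θa m 1 3
  have a1_5 := b_rel_θa m 1 4
  have a2_4 := b_rel_θa m 2 3
  norm_num1 at wn3_4 wn2_4 wn2_5 wn1_4 w0_4 w0_5 w1_4 w2_4 an3_4 an3_5 an2_4 an2_5
  norm_num1 at an1_4 an1_5 a0_4 a0_5 a1_4 a1_5 a2_4 hS
  field_simp at hS
  have hD : (4 * (m + 2) * (m + 3) : ℚ) ≠ 0 := by positivity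
  apply mul_left_cancel₀ hD
  linear_combination (2 * (m + 2) * (m + 3) * (m + 4) * (m + 6) ^ 2 * (m + 7)) * hS
    + (-3 * m ^ 6 - 89 * m ^ 5 - 1073 * m ^ 4 - 6691 * m ^ 3 - 22612 * m ^ 2 - 38820 * m - 25992) *
      (m + 2) * wn3_4
    + (-6 * m ^ 7 - 176 * m ^ 6 - 2080 * m ^ 5 - 12492 * m ^ 4 - 38906 * m ^ 3 - 53140 * m ^ 2 -
      3072 * m + 39024) * wn2_4
    + 2 * (m + 2) * (m + 3) * (m + 3) * (m + 4) * (m + 4) * (m + 6) * (m + 7) * wn2_5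
    + (48 * m ^ 6 + 1436 * m ^ 5 + 17516 * m ^ 4 + 111028 * m ^ 3 + 383500 * m ^ 2 + 678792 * m +
      475056) * wn1_4
    + (9 * m ^ 4 + 189 * m ^ 3 + 1383 * m ^ 2 + 4095 * m + 4068) * (m + 5) * (m + 6) * (m + 6) *
      w0_4
    + (-2) * (m + 2) * (m + 3) * (m + 3) * (m + 4) * (m + 4) * (m + 6) * (m + 7) * w0_5
    + (8 * m ^ 2 + 57 * m + 87) * (m + 4) * (m + 5) * (m + 6) * (m + 6) * (m + 7) * w1_4
    + 2 * (m + 3) * (m + 3) * (m + 4) * (m + 5) * (m + 6) * (m + 6) * (m + 7) * w2_4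
    + (2 * m ^ 6 + 70 * m ^ 5 + 1014 * m ^ 4 + 7778 * m ^ 3 + 33208 * m ^ 2 + 74712 * m + 68976) *
      (m + 2) * an3_4
    + (-2 * m ^ 6 - 70 * m ^ 5 - 1014 * m ^ 4 - 7778 * m ^ 3 - 32920 * m ^ 2 - 72600 * m - 65232) *
      (m + 2) * an3_5
    + (24 * m ^ 7 + 836 * m ^ 6 + 12292 * m ^ 5 + 98676 * m ^ 4 + 465572 * m ^ 3 + 1285192 *
      m ^ 2 + 1909344 * m + 1166688) * an2_4
    + (-8 * m ^ 7 - 284 * m ^ 6 - 4268 * m ^ 5 - 35132 * m ^ 4 - 170060 * m ^ 3 - 480872 * m ^ 2 -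
      729888 * m - 454176) * an2_5
    + (56 * m ^ 7 + 1944 * m ^ 6 + 28464 * m ^ 5 + 227392 * m ^ 4 + 1067320 * m ^ 3 + 2931512 *
      m ^ 2 + 4337232 * m + 2643552) * an1_4
    + (-12 * m ^ 7 - 412 * m ^ 6 - 5988 * m ^ 5 - 47740 * m ^ 4 - 224784 * m ^ 3 - 621976 * m ^ 2 -
      930000 * m - 573984) * an1_5
    + (54 * m ^ 4 + 954 * m ^ 3 + 5970 * m ^ 2 + 15606 * m + 14184) * (m + 5) * (m + 6) * (m + 6) *
      a0_4
    + (-6 * m ^ 5 - 154 * m ^ 4 - 1530 * m ^ 3 - 7358 * m ^ 2 - 16944 * m - 14616) * (m + 4) * (m +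
      5) * a0_5
    + (24 * m ^ 2 + 154 * m + 222) * (m + 4) * (m + 5) * (m + 6) * (m + 6) * (m + 7) * a1_4
    + (-6) * (m + 3) * (m + 3) * (m + 4) * (m + 5) * (m + 6) * (m + 6) * a1_5
    + 4 * (m + 3) * (m + 3) * (m + 4) * (m + 5) * (m + 6) * (m + 6) * (m + 7) * a2_4

theorem b_succ_zero (m : ℕ) : 4 * (m + 4) ^ 2 * b (m + 1) (-3) 4 =
      (2 * m ^ 2 + 26 * m + 80) * b m (-3) 4 +
      (10 * m ^ 2 + 70 * m + 116) * b m (-3) 5 := by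
  have hS := b_succ_left m (-3) 4
  have wn4_4 := b_rel_θw m (-4) 3
  have an4_4 := b_rel_θa m (-4) 3
  have an4_5 := b_rel_θa m (-4) 4
  norm_num1 at wn4_4 an4_4 an4_5 hS
  linear_combination 4 * (m + 4) ^ 2 * hS
    + (m + 5) * wn4_4
    + (2 * m + 10) * an4_4
    + (-6 * m - 26) * an4_5

theorem b_succ_one (m : ℕ) : 4 * (m + 3) * (m + 4) ^ 2 * (m + 6) * b (m + 1) (-3) 5 =
      (10 * m ^ 4 + 208 * m ^ 3 + 1562 * m ^ 2 + 5044 * m + 5920) * b m (-3) 4 +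
      (42 * m ^ 4 + 660 * m ^ 3 + 3786 * m ^ 2 + 9384 * m + 8456) * b m (-3) 5 := by
  have hS := b_succ_left m (-3) 5
  have wn4_5 := b_rel_θw m (-4) 4
  have wn3_5 := b_rel_θw m (-3) 4
  have an4_5 := b_rel_θa m (-4) 4
  have an4_6 := b_rel_θa m (-4) 5
  have an3_5 := b_rel_θa m (-3) 4
  norm_num1 at wn4_5 wn3_5 an4_5 an4_6 an3_5 hS
  linear_combination 4 * (m + 3) * (m + 4) ^ 2 * (m + 6) * hS
    + (m + 6) * (m + 3) * (m + 6) * wn4_5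
    + (10 * m ^ 2 + 78 * m + 148) * (m + 3) * wn3_5
    + (2 * m + 12) * (m + 3) * (m + 6) * an4_5
    + (-6 * m - 28) * (m + 3) * (m + 6) * an4_6
    + (40 * m ^ 3 + 532 * m ^ 2 + 2308 * m + 3256) * an3_5

theorem treeCount_add_four (m : ℕ) :
    ((m + 9) * (m + 8) * treeCount (m + 4) 1 1 : ℚ) =
      (11 * (m + 5) ^ 2 + 11 * (m + 5) - 6) * treeCount (m + 3) 1 1 +
        (m + 2) * (m + 3) * treeCount (m + 2) 1 1 := by
  have t0 := treeCount_eq_b m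
  have t1 := treeCount_eq_b (m + 1)
  have t2 := treeCount_eq_b (m + 2)
  have c0 := b_succ_zero m
  have c1 := b_succ_zero (m + 1)
  have d0 := b_succ_one m
  have d1 := b_succ_one (m + 1)
  simp only [add_assoc, Nat.reduceAdd] at t0 t1 t2 c0 c1 d0 d1
  push_cast at t0 t1 t2 c0 c1 d0 d1
  generalize b m (-3) 4 = p₀ at *
  generalize b m (-3) 5 = q₀ at *
  generalize b (m + 1) (-3) 4 = p₁ at *
  generalize b (m + 1) (-3) 5 = q₁ at *
  generalize b (m + 2) (-3) 4 = p₂ at *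
  generalize b (m + 2) (-3) 5 = q₂ at *
  generalize (treeCount (m + 2) 1 1 : ℚ) = x₀ at *
  generalize (treeCount (m + 3) 1 1 : ℚ) = x₁ at *
  generalize (treeCount (m + 4) 1 1 : ℚ) = x₂ at *
  have hm : (0 : ℚ) ≤ m := Nat.cast_nonneg m
  generalize (m : ℚ) = μ at *
  rw [mul_comm, ← eq_div_iff (by positivity)] at t0 t1 t2 c0 c1 d0 d1
  subst t0 t1 t2
  subst c1 d1
  subst c0 d0
  field_simp
  ring

end Laurent₂

namespace SemiBaxter

open Finset

/-- Append a last entry of value `v` to the one-line notation of `π`. -/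
def insertLast {n : ℕ} (v : Fin (n + 1)) (π : Equiv.Perm (Fin n)) : Equiv.Perm (Fin (n + 1)) :=
  (finSuccEquiv' (Fin.last n)).trans (π.optionCongr.trans (finSuccEquiv' v).symm)

variable {n : ℕ}

@[simp]
theorem insertLast_last (v : Fin (n + 1)) (π : Equiv.Perm (Fin n)) :
    insertLast v π (Fin.last n) = v := by
  simp [insertLast]

@[simp]
theorem insertLast_castSucc (v : Fin (n + 1)) (π : Equiv.Perm (Fin n)) (i : Fin n) :
    insertLast v π i.castSucc = v.succAbove (π i) := by
  simp [insertLast, finSuccEquiv'_last_apply_castSucc]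

theorem insertLast_bijective :
    Function.Bijective fun x : Fin (n + 1) × Equiv.Perm (Fin n) => insertLast x.1 x.2 := by
  rw [Fintype.bijective_iff_injective_and_card]
  constructor
  · rintro ⟨v, π⟩ ⟨v', π'⟩ h
    have hv : v = v' := by simpa using DFunLike.congr_fun h (Fin.last n)
    subst hv
    have hπ : π = π' := by
      ext i : 1
      simpa using DFunLike.congr_fun h i.castSucc
    rw [hπ]
  · simp [Fintype.card_perm, Nat.factorial_succ]

/-- The value `v` can be appended to `π` without completing an occurrence of 2-41-3. -/
def IsActive (π : Equiv.Perm (Fin n)) (v : ℕ) : Prop :=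
  ∀ i j j' : Fin n, (i : ℕ) < j → (j' : ℕ) = j + 1 → π j' < π i → (π i : ℕ) < v → (π j : ℕ) < v

theorem isSemiBaxter_insertLast (v : Fin (n + 1)) (π : Equiv.Perm (Fin n)) :
    IsSemiBaxter (insertLast v π) ↔ IsSemiBaxter π ∧ IsActive π v := by
  constructor
  · intro h
    constructor
    · rintro ⟨i, j, j', k, h₁, h₂, h₃, h₄, h₅, h₆⟩
      exact h ⟨i.castSucc, j.castSucc, j'.castSucc, k.castSucc, by simpa using h₁,
        by simpa using h₂, by simpa using h₃, by simpa using h₄, by simpa using h₅,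
        by simpa using h₆⟩
    · intro i j j' h₁ h₂ h₃ h₄
      by_contra h₅
      exact h ⟨i.castSucc, j.castSucc, j'.castSucc, Fin.last n, by simpa using h₁,
        by simpa using h₂, by simp, by simpa using h₃,
        by rw [insertLast_castSucc, insertLast_last, Fin.succAbove_lt_iff_castSucc_lt]; exact h₄,
        by simpa [Fin.lt_succAbove_iff_le_castSucc, Fin.le_def] using h₅⟩
  · rintro ⟨hπ, hv⟩ ⟨i, j, j', k, h₁, h₂, h₃, h₄, h₅, h₆⟩
    obtain ⟨i, rfl⟩ := Fin.exists_castSucc_eq.2 (show i ≠ Fin.last n by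
      rintro rfl; rw [Fin.val_last] at h₁; omega)
    obtain ⟨j, rfl⟩ := Fin.exists_castSucc_eq.2 (show j ≠ Fin.last n by
      rintro rfl; rw [Fin.val_last] at h₂; omega)
    obtain ⟨j', rfl⟩ := Fin.exists_castSucc_eq.2 (show j' ≠ Fin.last n by
      rintro rfl; rw [Fin.val_last] at h₃; omega)
    simp only [insertLast_castSucc, Fin.succAbove_lt_succAbove_iff, Fin.val_castSucc] at *
    induction k using Fin.lastCases with
    | last =>
      rw [insertLast_last, Fin.succAbove_lt_iff_castSucc_lt] at h₅
      rw [insertLast_last, Fin.lt_succAbove_iff_le_castSucc] at h₆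
      simp only [Fin.lt_def, Fin.le_def, Fin.val_castSucc] at h₅ h₆
      have := hv i j j' h₁ h₂ h₄ h₅
      omega
    | cast k =>
      simp only [insertLast_castSucc, Fin.succAbove_lt_succAbove_iff, Fin.val_castSucc] at *
      exact hπ ⟨i, j, j', k, h₁, h₂, h₃, h₄, h₅, h₆⟩

theorem isActive_insertLast (v : Fin (n + 2)) (π : Equiv.Perm (Fin (n + 1))) (u : ℕ) :
    IsActive (insertLast v π) u ↔
      if u ≤ v then IsActive π u
      else IsActive π (u - 1) ∧ ¬ (v + 1 < u ∧ u ≤ π (Fin.last n) + 1) := by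
  have hval (x : Fin (n + 1)) : (v.succAbove x : ℕ) = if (x : ℕ) < v then (x : ℕ) else x + 1 := by
    simp only [Fin.succAbove, Fin.lt_def, Fin.val_castSucc]
    split_ifs <;> simp
  have hold : (∀ i j j' : Fin (n + 1), (i : ℕ) < j → (j' : ℕ) = j + 1 → π j' < π i →
      (v.succAbove (π i) : ℕ) < u → (v.succAbove (π j) : ℕ) < u) ↔
      if u ≤ v then IsActive π u else IsActive π (u - 1) := by
    unfold IsActive
    split_ifs with hu <;>
    · refine forall₃_congr fun i j j' => forall₃_congr fun h₁ h₂ h₃ => ?_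
      rw [hval, hval]
      split_ifs <;> omega
  have hnew : (∀ i : Fin (n + 1), (i : ℕ) < n → (v : ℕ) < v.succAbove (π i) →
      (v.succAbove (π i) : ℕ) < u → (v.succAbove (π (Fin.last n)) : ℕ) < u) ↔
      ¬ (v + 1 < u ∧ u ≤ π (Fin.last n) + 1) := by
    constructor
    · rintro h ⟨h₁, h₂⟩
      have hlt := (π (Fin.last n)).isLt
      obtain ⟨i, hi⟩ := π.surjective ⟨u - 2, by omega⟩
      have hi' : (π i : ℕ) = u - 2 := by rw [hi]
      have hin : (i : ℕ) < n := by
        refine lt_of_le_of_ne (Nat.lt_succ_iff.1 i.isLt) fun h => ?_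
        have : i = Fin.last n := Fin.ext h
        rw [this] at hi'
        omega
      have := h i hin
      rw [hval, hval] at this
      split_ifs at this <;> omega
    · intro h i hi
      have hne : (π i : ℕ) ≠ π (Fin.last n) := fun h => by
        have := π.injective (Fin.ext h)
        subst this
        simp at hi
      rw [hval, hval]
      split_ifs <;> omega
  have key : IsActive (insertLast v π) u ↔
      (∀ i j j' : Fin (n + 1), (i : ℕ) < j → (j' : ℕ) = j + 1 → π j' < π i →
        (v.succAbove (π i) : ℕ) < u → (v.succAbove (π j) : ℕ) < u) ∧
      (∀ i : Fin (n + 1), (i : ℕ) < n → (v : ℕ) < v.succAbove (π i) →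
        (v.succAbove (π i) : ℕ) < u → (v.succAbove (π (Fin.last n)) : ℕ) < u) := by
    constructor
    · intro h
      refine ⟨fun i j j' h₁ h₂ h₃ => ?_, fun i h₁ h₂ => ?_⟩
      · simpa using h i.castSucc j.castSucc j'.castSucc (by simpa using h₁) (by simpa using h₂)
          (by simpa using h₃)
      · simpa using h i.castSucc (Fin.last n).castSucc (Fin.last (n + 1)) (by simpa using h₁)
          (by simp) (by rw [insertLast_last, insertLast_castSucc]; exact h₂)
    · rintro ⟨h, h'⟩ i j j' h₁ h₂ h₃
      have hj' := j'.isLt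
      obtain ⟨i, rfl⟩ := Fin.exists_castSucc_eq.2 (show i ≠ Fin.last (n + 1) by
        rintro rfl; rw [Fin.val_last] at h₁; omega)
      obtain ⟨j, rfl⟩ := Fin.exists_castSucc_eq.2 (show j ≠ Fin.last (n + 1) by
        rintro rfl; rw [Fin.val_last] at h₂; omega)
      induction j' using Fin.lastCases with
      | last =>
        have hj : j = Fin.last n := Fin.ext (by simpa using h₂.symm)
        subst hj
        rw [insertLast_last, insertLast_castSucc] at h₃
        simpa using h' i (by simpa using h₁) h₃
      | cast j' =>
        simpa using h i j j' (by simpa using h₁) (by simpa using h₂) (by simpa using h₃)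
  rw [key, hold, hnew]
  split_ifs with hu
  · exact and_iff_left fun h => by omega
  · rfl

open Classical in
/-- The values that can be appended to `π` without completing an occurrence of 2-41-3. -/
noncomputable def activeSites (π : Equiv.Perm (Fin n)) : Finset ℕ :=
  (range (n + 1)).filter (IsActive π)

/-- The number of active sites at or below the last entry of `π`. -/
noncomputable def low (π : Equiv.Perm (Fin (n + 1))) : ℕ :=
  #{u ∈ activeSites π | u ≤ (π (Fin.last n) : ℕ)}

/-- The number of active sites above the last entry of `π`. -/
noncomputable def high (π : Equiv.Perm (Fin (n + 1))) : ℕ :=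
  #{u ∈ activeSites π | (π (Fin.last n) : ℕ) < u}

theorem mem_activeSites {π : Equiv.Perm (Fin n)} {u : ℕ} :
    u ∈ activeSites π ↔ u ≤ n ∧ IsActive π u := by
  simp [activeSites]

theorem low_insertLast (v : Fin (n + 2)) (π : Equiv.Perm (Fin (n + 1))) :
    low (insertLast v π) = #{u ∈ activeSites π | u ≤ (v : ℕ)} := by
  unfold low
  congr 1
  ext u
  have := v.isLt
  simp only [mem_filter, mem_activeSites, isActive_insertLast, insertLast_last]
  constructor
  · rintro ⟨⟨h₁, h₂⟩, h₃⟩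
    rw [if_pos h₃] at h₂
    exact ⟨⟨by omega, h₂⟩, h₃⟩
  · rintro ⟨⟨h₁, h₂⟩, h₃⟩
    exact ⟨⟨by omega, by rwa [if_pos h₃]⟩, h₃⟩

theorem high_insertLast (v : Fin (n + 2)) (π : Equiv.Perm (Fin (n + 1))) :
    high (insertLast v π) =
      #{u ∈ activeSites π | (v : ℕ) ≤ u ∧ ((v : ℕ) < u → (π (Fin.last n) : ℕ) < u)} := by
  unfold high
  symm
  refine card_bij' (fun u _ => u + 1) (fun u _ => u - 1) ?_ ?_ ?_ ?_
  · intro u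
    simp only [mem_filter, mem_activeSites, isActive_insertLast, insertLast_last]
    rintro ⟨⟨h₁, h₂⟩, h₃, h₄⟩
    rw [if_neg (by omega)]
    exact ⟨⟨by omega, h₂, by omega⟩, by omega⟩
  · intro u
    simp only [mem_filter, mem_activeSites, isActive_insertLast, insertLast_last]
    rintro ⟨⟨h₁, h₂⟩, h₃⟩
    rw [if_neg (by omega)] at h₂
    exact ⟨⟨by omega, h₂.1⟩, by omega, by omega⟩
  · intro u _
    rfl
  · intro u
    simp only [mem_filter, insertLast_last]
    omega

theorem high_insertLast_of_le {v : Fin (n + 2)} {π : Equiv.Perm (Fin (n + 1))}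
    (hv : IsActive π v) (h : (v : ℕ) ≤ π (Fin.last n)) :
    high (insertLast v π) = high π + 1 := by
  have hmem : (v : ℕ) ∉ {u ∈ activeSites π | (π (Fin.last n) : ℕ) < u} := by simp [h]
  rw [high_insertLast, high, ← card_insert_of_notMem hmem]
  congr 1
  ext u
  have := v.isLt
  simp only [mem_filter, mem_insert, mem_activeSites]
  constructor
  · rintro ⟨h₁, h₂, h₃⟩
    by_cases huv : u = v
    · exact Or.inl huv
    · exact Or.inr ⟨h₁, h₃ (by omega)⟩
  · rintro (rfl | ⟨h₁, h₂⟩)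
    · exact ⟨⟨by omega, hv⟩, le_rfl, fun h => absurd h (lt_irrefl _)⟩
    · exact ⟨h₁, by omega, fun _ => h₂⟩

theorem high_insertLast_of_lt {v : Fin (n + 2)} {π : Equiv.Perm (Fin (n + 1))}
    (hv : IsActive π v) (h : (π (Fin.last n) : ℕ) < v) :
    high (insertLast v π) =
      high π + 1 - #{u ∈ {u ∈ activeSites π | (π (Fin.last n) : ℕ) < u} | u ≤ (v : ℕ)} := by
  have h₁ : high (insertLast v π) =
      #{u ∈ {u ∈ activeSites π | (π (Fin.last n) : ℕ) < u} | ¬ u ≤ (v : ℕ)} + 1 := by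
    have hmem : (v : ℕ) ∉ {u ∈ {u ∈ activeSites π | (π (Fin.last n) : ℕ) < u} | ¬ u ≤ (v : ℕ)} := by
      simp
    rw [high_insertLast, ← card_insert_of_notMem hmem]
    congr 1
    ext u
    have := v.isLt
    simp only [mem_filter, mem_insert, mem_activeSites]
    constructor
    · rintro ⟨h₁, h₂, h₃⟩
      by_cases huv : u = v
      · exact Or.inl huv
      · exact Or.inr ⟨⟨h₁, by omega⟩, by omega⟩
    · rintro (rfl | ⟨⟨h₁, h₂⟩, h₃⟩)
      · exact ⟨⟨by omega, hv⟩, le_rfl, fun h => absurd h (lt_irrefl _)⟩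
      · exact ⟨h₁, by omega, fun _ => h₂⟩
  have h₂ := card_filter_add_card_filter_not (s := {u ∈ activeSites π | (π (Fin.last n) : ℕ) < u})
    (fun u => u ≤ (v : ℕ))
  rw [h₁]
  unfold high
  omega

theorem low_insertLast_of_lt {v : Fin (n + 2)} {π : Equiv.Perm (Fin (n + 1))}
    (h : (π (Fin.last n) : ℕ) < v) :
    low (insertLast v π) =
      low π + #{u ∈ {u ∈ activeSites π | (π (Fin.last n) : ℕ) < u} | u ≤ (v : ℕ)} := by
  rw [low_insertLast, low, ← card_union_of_disjoint]
  · congr 1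
    ext u
    simp only [mem_filter, mem_union]
    constructor
    · rintro ⟨h₁, h₂⟩
      by_cases hu : u ≤ (π (Fin.last n) : ℕ)
      · exact Or.inl ⟨h₁, hu⟩
      · exact Or.inr ⟨⟨h₁, by omega⟩, h₂⟩
    · rintro (⟨h₁, h₂⟩ | ⟨⟨h₁, h₂⟩, h₃⟩)
      · exact ⟨h₁, by omega⟩
      · exact ⟨h₁, h₃⟩
  · rw [disjoint_left]
    intro u
    simp only [mem_filter]
    omega

theorem sum_card_filter_le (A : Finset ℕ) (F : ℕ → ℕ) :
    ∑ v ∈ A, F #{u ∈ A | u ≤ v} = ∑ i ∈ range #A, F (i + 1) := by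
  induction A using Finset.induction_on_max with
  | empty => simp
  | insert a A ha ih =>
    have hA : a ∉ A := fun h => lt_irrefl _ (ha a h)
    rw [sum_insert hA, card_insert_of_notMem hA, sum_range_succ, ← ih, add_comm]
    congr 1
    · refine sum_congr rfl fun v hv => ?_
      rw [filter_insert, if_neg (by simpa using ha v hv)]
    · rw [filter_true_of_mem, card_insert_of_notMem hA]
      intro u hu
      rcases mem_insert.1 hu with rfl | hu
      · exact le_rfl
      · exact (ha u hu).le

open Classical in
theorem sum_insertLast (m : ℕ) (π : Equiv.Perm (Fin (n + 1))) :
    (∑ v : Fin (n + 2), if IsActive π v then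
        Laurent₂.treeCount m (low (insertLast v π)) (high (insertLast v π)) else 0) =
      Laurent₂.treeCount (m + 1) (low π) (high π) := by
  set B := {u ∈ activeSites π | u ≤ (π (Fin.last n) : ℕ)} with hB
  set C := {u ∈ activeSites π | (π (Fin.last n) : ℕ) < u} with hC
  have hterm (v : Fin (n + 2)) : (if IsActive π v then
      Laurent₂.treeCount m (low (insertLast v π)) (high (insertLast v π)) else 0) =
      if IsActive π v then (if (v : ℕ) ≤ π (Fin.last n) then
        Laurent₂.treeCount m #{u ∈ B | u ≤ (v : ℕ)} (high π + 1) else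
        Laurent₂.treeCount m (low π + #{u ∈ C | u ≤ (v : ℕ)})
          (high π + 1 - #{u ∈ C | u ≤ (v : ℕ)})) else 0 := by
    split_ifs with hv hle
    · rw [high_insertLast_of_le hv hle, low_insertLast, hB, filter_filter]
      congr 2
      ext u
      simp only [mem_filter]
      refine and_congr_right fun _ => ⟨fun h => ⟨by omega, h⟩, fun h => h.2⟩
    · rw [not_le] at hle
      rw [high_insertLast_of_lt hv hle, low_insertLast_of_lt hle]
    · rfl
  rw [sum_congr rfl fun v _ => hterm v, ← sum_range (n := n + 2) (fun v => if IsActive π v then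
    (if v ≤ (π (Fin.last n) : ℕ) then Laurent₂.treeCount m #{u ∈ B | u ≤ v} (high π + 1) else
      Laurent₂.treeCount m (low π + #{u ∈ C | u ≤ v}) (high π + 1 - #{u ∈ C | u ≤ v})) else 0),
    ← sum_filter, sum_ite]
  simp only [not_le]
  rw [show (range (n + 2)).filter (IsActive π) = activeSites π from rfl, ← hB, ← hC,
    sum_card_filter_le B (fun i => Laurent₂.treeCount m i (high π + 1)),
    sum_card_filter_le C (fun i => Laurent₂.treeCount m (low π + i) (high π + 1 - i)),
    Laurent₂.treeCount]
  congr 1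
  refine sum_congr rfl fun j _ => ?_
  rw [Nat.add_sub_add_right, add_assoc]

open Classical in
theorem sum_treeCount_succ (m n : ℕ) :
    (∑ π : Equiv.Perm (Fin (n + 2)), if IsSemiBaxter π then
        Laurent₂.treeCount m (low π) (high π) else 0) =
      ∑ π : Equiv.Perm (Fin (n + 1)), if IsSemiBaxter π then
        Laurent₂.treeCount (m + 1) (low π) (high π) else 0 := by
  rw [← insertLast_bijective.sum_comp, Fintype.sum_prod_type_right]
  refine sum_congr rfl fun π _ => ?_
  simp only [isSemiBaxter_insertLast, ite_and]
  split_ifs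
  · exact sum_insertLast m π
  · simp

theorem isActive_of_subsingleton (π : Equiv.Perm (Fin 1)) (u : ℕ) : IsActive π u := by
  intro i j j' h
  omega

theorem semiBaxterCount_succ (n : ℕ) : semiBaxterCount (n + 1) = Laurent₂.treeCount n 1 1 := by
  classical
  have h (m : ℕ) : (∑ π : Equiv.Perm (Fin (n + 1)), if IsSemiBaxter π then
      Laurent₂.treeCount m (low π) (high π) else 0) = Laurent₂.treeCount (m + n) 1 1 := by
    induction n generalizing m with
    | zero =>
      have hπ (π : Equiv.Perm (Fin 1)) : IsSemiBaxter π := by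
        rintro ⟨i, j, j', k, h, -⟩
        omega
      have hsites (π : Equiv.Perm (Fin 1)) : activeSites π = range 2 := by
        ext u
        simp [mem_activeSites, isActive_of_subsingleton]
      simp [hπ, low, high, hsites]
      rfl
    | succ n ih =>
      rw [sum_treeCount_succ, ih, Nat.add_right_comm, add_assoc]
  rw [semiBaxterCount, Nat.card_eq_fintype_card, Fintype.card_subtype, card_filter]
  simpa [Laurent₂.treeCount] using h 0

end SemiBaxter

/-- Proposition 3.11: the recurrence satisfied by the semi-Baxter numbers. -/
theorem semiBaxter_rec :
    semiBaxterCount 1 = 1 ∧ semiBaxterCount 2 = 2 ∧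
    ∀ n : ℕ, 3 ≤ n →
      ((n : ℤ) + 4) * ((n : ℤ) + 3) * (semiBaxterCount n : ℤ) =
        (11 * (n : ℤ) ^ 2 + 11 * (n : ℤ) - 6) * (semiBaxterCount (n - 1) : ℤ) +
          ((n : ℤ) - 3) * ((n : ℤ) - 2) * (semiBaxterCount (n - 2) : ℤ) := by
  have h (k : ℕ) (hk : k ≠ 0) : semiBaxterCount k = Laurent₂.treeCount (k - 1) 1 1 := by
    rw [← SemiBaxter.semiBaxterCount_succ, Nat.sub_add_cancel (Nat.one_le_iff_ne_zero.2 hk)]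
  refine ⟨h 1 (by simp), h 2 (by simp), fun n hn => ?_⟩
  rw [h n (by omega), h (n - 1) (by omega), h (n - 2) (by omega)]
  obtain rfl | rfl | ⟨m, rfl⟩ : n = 3 ∨ n = 4 ∨ ∃ m, n = m + 5 := by
    rcases Nat.lt_or_ge n 5 with h5 | h5
    · omega
    · exact Or.inr (Or.inr ⟨n - 5, by omega⟩)
  · simp [Laurent₂.treeCount]
  · simp [Laurent₂.treeCount, Finset.sum_range_succ]
  · have key := Laurent₂.treeCount_add_four m
    have h₁ : m + 5 - 1 = m + 4 := rfl
    have h₂ : m + 4 - 1 = m + 3 := rfl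
    have h₃ : m + 5 - 2 - 1 = m + 2 := rfl
    rw [h₁, h₂, h₃]
    qify
    linear_combination key
end

section
/- Let SB_n denote the number of semi-Baxter permutations of size n. For every n ≥ 2, (n−1)·n²·(n+1)·(n+2)·SB_n = 24·Σ_{j=0}^{n} binomial(n, j+2)·binomial(n+2, j)·binomial(n+j+2, j+1). (Theorem 3.13, first formula.) -/
open Finset

section GeneratingTree

/-- The permutation obtained from `π` by appending the last value `a`, the values that are at
least `a` being shifted up by one. -/
noncomputable def appendLast {n : ℕ} (a : Fin (n + 1)) (π : Equiv.Perm (Fin n)) :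
    Equiv.Perm (Fin (n + 1)) :=
  Equiv.ofBijective (Fin.snoc (α := fun _ => Fin (n + 1)) (fun i => a.succAbove (π i)) a) <| by
    rw [← Finite.injective_iff_bijective]
    intro i j h
    induction i using Fin.lastCases with
    | last =>
      induction j using Fin.lastCases with
      | last => rfl
      | cast j => simp at h
    | cast i =>
      induction j using Fin.lastCases with
      | last => simp at h
      | cast j => simpa using h

@[simp]
lemma appendLast_last {n : ℕ} (a : Fin (n + 1)) (π : Equiv.Perm (Fin n)) :
    appendLast a π (Fin.last n) = a := by
  simp [appendLast]

@[simp]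
lemma appendLast_castSucc {n : ℕ} (a : Fin (n + 1)) (π : Equiv.Perm (Fin n)) (i : Fin n) :
    appendLast a π i.castSucc = a.succAbove (π i) := by
  simp [appendLast]

lemma appendLast_bijective (n : ℕ) :
    Function.Bijective fun p : Fin (n + 1) × Equiv.Perm (Fin n) => appendLast p.1 p.2 := by
  rw [Fintype.bijective_iff_injective_and_card]
  constructor
  · rintro ⟨a, π⟩ ⟨b, ρ⟩ h
    have hab : a = b := by simpa using DFunLike.congr_fun h (Fin.last n)
    subst hab
    refine Prod.ext rfl (Equiv.ext fun i => ?_)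
    simpa using DFunLike.congr_fun h i.castSucc
  · simp [Fintype.card_perm, Nat.factorial_succ]

lemma val_succAbove {n : ℕ} (a : Fin (n + 1)) (x : Fin n) :
    ((a.succAbove x : Fin (n + 1)) : ℕ) = if (x : ℕ) < a then (x : ℕ) else x + 1 := by
  simp only [Fin.succAbove, Fin.lt_def, Fin.val_castSucc]
  split_ifs <;> simp

/-- The values that can be appended to `π` without creating a 2-41-3 whose `3` is the new value. -/
noncomputable def activeSites {n : ℕ} (π : Equiv.Perm (Fin n)) : Finset ℕ := by
  classical exact (range (n + 1)).filter fun c => ∀ i j j' : Fin n, (i : ℕ) < j → (j' : ℕ) = j + 1 →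
    (π j' : ℕ) < π i → (π i : ℕ) < c → (π j : ℕ) < c

lemma mem_activeSites {n : ℕ} {π : Equiv.Perm (Fin n)} {c : ℕ} :
    c ∈ activeSites π ↔ c < n + 1 ∧ ∀ i j j' : Fin n, (i : ℕ) < j → (j' : ℕ) = j + 1 →
      (π j' : ℕ) < π i → (π i : ℕ) < c → (π j : ℕ) < c := by
  simp [activeSites]

lemma isSemiBaxter_appendLast {n : ℕ} (a : Fin (n + 1)) (π : Equiv.Perm (Fin n)) :
    IsSemiBaxter (appendLast a π) ↔ IsSemiBaxter π ∧ (a : ℕ) ∈ activeSites π := by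
  simp only [IsSemiBaxter, Contains2413, mem_activeSites, Fin.lt_def]
  push Not
  constructor
  · intro h
    refine ⟨fun i j j' k hij hj hk h1 h2 => ?_, a.2, fun i j j' hij hj h1 h2 => ?_⟩
    · have := h i.castSucc j.castSucc j'.castSucc k.castSucc
      simp only [Fin.val_castSucc, appendLast_castSucc, val_succAbove] at this
      grind
    · have := h i.castSucc j.castSucc j'.castSucc (Fin.last n)
      simp only [Fin.val_castSucc, appendLast_castSucc, val_succAbove, appendLast_last,
        Fin.val_last] at this
      have := j'.2
      grind
  · rintro ⟨h, -, ha⟩ i j j' k hij hj hk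
    obtain ⟨j', rfl⟩ := Fin.eq_castSucc_of_ne_last (x := j') (by
      rintro rfl; have := k.2; simp at hk; omega)
    obtain ⟨j, rfl⟩ := Fin.eq_castSucc_of_ne_last (x := j) (by
      rintro rfl; have := j'.2; simp at hj; omega)
    obtain ⟨i, rfl⟩ := Fin.eq_castSucc_of_ne_last (x := i) (by
      rintro rfl; have := j.2; simp at hij; omega)
    simp only [Fin.val_castSucc] at *
    induction k using Fin.lastCases with
    | last =>
      simp only [appendLast_castSucc, val_succAbove, appendLast_last]
      have := ha i j j' hij hj
      grind
    | cast k =>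
      simp only [appendLast_castSucc, val_succAbove]
      have := h i j j' k hij hj hk
      grind

variable {n : ℕ} {π : Equiv.Perm (Fin (n + 1))}

lemma val_apply_ne_last {i : Fin (n + 1)} (hi : (i : ℕ) < n) :
    (π i : ℕ) ≠ π (Fin.last n) := by
  intro h
  have : i = Fin.last n := π.injective (Fin.ext h)
  simp [this] at hi

lemma last_mem_activeSites (h : IsSemiBaxter π) : (π (Fin.last n) : ℕ) ∈ activeSites π := by
  simp only [IsSemiBaxter, Contains2413, Fin.lt_def] at h
  push Not at h
  refine mem_activeSites.2 ⟨by omega, fun i j j' hij hj h1 h2 => ?_⟩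
  have h3 := h i j j' (Fin.last n) hij hj
  have h4 := val_apply_ne_last (π := π) (i := j) (by omega)
  have h5 : (j' : ℕ) ≠ n := fun h5 => by
    have : j' = Fin.last n := Fin.ext h5
    subst this; omega
  simp only [Fin.val_last] at h3
  omega

lemma last_succ_mem_activeSites (h : IsSemiBaxter π) :
    (π (Fin.last n) : ℕ) + 1 ∈ activeSites π := by
  simp only [IsSemiBaxter, Contains2413, Fin.lt_def] at h
  push Not at h
  refine mem_activeSites.2 ⟨by omega, fun i j j' hij hj h1 h2 => ?_⟩
  have h3 := h i j j' (Fin.last n) hij hj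
  have h4 := val_apply_ne_last (π := π) (i := i) (by omega)
  have h5 : (j' : ℕ) ≠ n := fun h5 => by
    have : j' = Fin.last n := Fin.ext h5
    subst this; omega
  simp only [Fin.val_last] at h3
  omega

set_option maxHeartbeats 800000 in
lemma mem_activeSites_appendLast {a : Fin (n + 2)} (ha : (a : ℕ) ∈ activeSites π) (c : ℕ) :
    c ∈ activeSites (appendLast a π) ↔
      (c ≤ a ∧ c ∈ activeSites π) ∨ c = a + 1 ∨
        (a < c - 1 ∧ (π (Fin.last n) : ℕ) < c - 1 ∧ c - 1 ∈ activeSites π) := by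
  have ha' := (mem_activeSites.1 ha).2
  constructor
  · intro hc
    obtain ⟨hc1, hc2⟩ := mem_activeSites.1 hc
    have key : ∀ i j j' : Fin (n + 1), (i : ℕ) < j → (j' : ℕ) = j + 1 →
        (π j' : ℕ) < π i → _ := fun i j j' hij hj h1 =>
      hc2 i.castSucc j.castSucc j'.castSucc (by simpa) (by simpa)
        (by simp only [appendLast_castSucc, val_succAbove]; grind)
    simp only [appendLast_castSucc, val_succAbove] at key
    rcases lt_trichotomy c (a + 1) with h | h | h
    · refine Or.inl ⟨by omega, mem_activeSites.2 ⟨by omega, fun i j j' hij hj h1 h2 => ?_⟩⟩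
      have := key i j j' hij hj h1
      grind
    · exact Or.inr (Or.inl h)
    · refine Or.inr (Or.inr ⟨by omega, ?_, mem_activeSites.2 ⟨by omega, ?_⟩⟩)
      · by_contra hl
        have hlt : (a : ℕ) < n + 1 := by
          have := (π (Fin.last n)).2
          omega
        obtain ⟨i, hi⟩ := π.surjective ⟨a, hlt⟩
        have hi' : (π i : ℕ) = a := by rw [hi]
        have hin : (i : ℕ) ≠ n := by
          intro h5
          have : i = Fin.last n := Fin.ext h5
          subst this; omega
        have := hc2 i.castSucc (Fin.last n).castSucc (Fin.last (n + 1))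
          (by simp; omega) (by simp)
        simp only [appendLast_castSucc, val_succAbove, appendLast_last] at this
        rw [if_neg (by omega), if_neg (by omega)] at this
        have := this (by omega) (by omega)
        omega
      · intro i j j' hij hj h1 h2
        have := key i j j' hij hj h1
        grind
  · intro hc
    have hcn : c < n + 1 + 1 + 1 := by
      rcases hc with ⟨-, hc⟩ | hc | ⟨-, -, hc⟩
      · have := (mem_activeSites.1 hc).1; omega
      · omega
      · have := (mem_activeSites.1 hc).1; omega
    refine mem_activeSites.2 ⟨hcn, fun i j j' hij hj => ?_⟩
    obtain ⟨j, rfl⟩ := Fin.eq_castSucc_of_ne_last (x := j) (by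
      rintro rfl; have := j'.2; simp at hj; omega)
    obtain ⟨i, rfl⟩ := Fin.eq_castSucc_of_ne_last (x := i) (by
      rintro rfl; have := j.2; simp at hij; omega)
    simp only [Fin.val_castSucc] at *
    induction j' using Fin.lastCases with
    | last =>
      simp only [appendLast_castSucc, val_succAbove, appendLast_last]
      have : j = Fin.last n := Fin.ext (by simp at hj; simp; omega)
      subst this
      grind
    | cast j' =>
      simp only [appendLast_castSucc, val_succAbove]
      have h1 := ha' i j j' hij hj
      rcases hc with ⟨h, hc⟩ | hc | ⟨h, h', hc⟩
      · have := (mem_activeSites.1 hc).2 i j j' hij hj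
        grind
      · grind
      · have := (mem_activeSites.1 hc).2 i j j' hij hj
        grind

/-- The number of active sites strictly below the last value. -/
noncomputable def lowLabel (π : Equiv.Perm (Fin (n + 1))) : ℕ :=
  #{c ∈ activeSites π | c < (π (Fin.last n) : ℕ)}

/-- The number of active sites above the last value, not counting the one immediately above. -/
noncomputable def highLabel (π : Equiv.Perm (Fin (n + 1))) : ℕ :=
  #{c ∈ activeSites π | (π (Fin.last n) : ℕ) + 1 < c}

lemma lowLabel_appendLast {a : Fin (n + 2)} (ha : (a : ℕ) ∈ activeSites π) :
    lowLabel (appendLast a π) = #{c ∈ activeSites π | c < (a : ℕ)} := by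
  unfold lowLabel
  congr 1
  ext c
  simp only [mem_filter, mem_activeSites_appendLast ha, appendLast_last]
  grind

lemma highLabel_appendLast {a : Fin (n + 2)} (ha : (a : ℕ) ∈ activeSites π) :
    highLabel (appendLast a π) =
      #{c ∈ activeSites π | (a : ℕ) < c ∧ (π (Fin.last n) : ℕ) < c} := by
  unfold highLabel
  conv_rhs => rw [← card_image_of_injective _ (add_left_injective 1)]
  congr 1
  ext c
  simp only [mem_filter, mem_image, mem_activeSites_appendLast ha, appendLast_last]
  constructor
  · rintro ⟨h1, h2⟩
    have h3 : c ≠ 0 := by omega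
    exact ⟨c - 1, by grind, by omega⟩
  · rintro ⟨d, hd, rfl⟩
    simp only [Nat.add_sub_cancel]
    grind

lemma card_le_last (h : IsSemiBaxter π) :
    #{c ∈ activeSites π | c ≤ (π (Fin.last n) : ℕ)} = lowLabel π + 1 := by
  rw [lowLabel, ← card_insert_of_notMem (a := (π (Fin.last n) : ℕ)) (by simp)]
  congr 1
  ext c
  have := last_mem_activeSites h
  simp only [mem_filter, mem_insert]
  grind

lemma card_gt_last (h : IsSemiBaxter π) :
    #{c ∈ activeSites π | (π (Fin.last n) : ℕ) < c} = highLabel π + 1 := by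
  rw [highLabel, ← card_insert_of_notMem (a := (π (Fin.last n) : ℕ) + 1) (by simp)]
  congr 1
  ext c
  have := last_succ_mem_activeSites h
  simp only [mem_filter, mem_insert]
  grind

lemma sum_card_filter_lt {α M : Type*} [LinearOrder α] [AddCommMonoid M] (A : Finset α)
    (f : ℕ → M) : ∑ a ∈ A, f #{c ∈ A | c < a} = ∑ i ∈ range #A, f i := by
  induction A using Finset.induction_on_max with
  | empty => simp
  | insert a A h ih =>
    have ha : a ∉ A := fun h' => lt_irrefl _ (h a h')
    rw [sum_insert ha, card_insert_of_notMem ha, sum_range_succ, ← ih, add_comm]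
    congr 1
    · refine sum_congr rfl fun b hb => ?_
      rw [filter_insert, if_neg (not_lt.2 (h b hb).le)]
    · rw [filter_insert, if_neg (lt_irrefl _), filter_true_of_mem h]

lemma sum_children {R : Type*} [CommRing R] (h : IsSemiBaxter π) (a c : R) :
    a * c * ∑ s ∈ activeSites π, (1 + a) ^ #{d ∈ activeSites π | d < s} *
        (1 + a + c) ^ #{d ∈ activeSites π | s < d ∧ (π (Fin.last n) : ℕ) < d} =
      (a + c) * (1 + a) * (1 + a + c) * ((1 + a) ^ lowLabel π * (1 + a + c) ^ highLabel π) -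
        c * (1 + a + c) * (1 + a + c) ^ highLabel π -
        a * (1 + a) ^ 2 * (1 + a) ^ (lowLabel π + highLabel π) := by
  set l := (π (Fin.last n) : ℕ)
  set A := activeSites π
  set y := 1 + a
  set z := 1 + a + c
  have hL : #{c ∈ A | c ≤ l} = lowLabel π + 1 := card_le_last h
  have hK : #{c ∈ A | l < c} = highLabel π + 1 := card_gt_last h
  have hlow : ∑ s ∈ A with s ≤ l, y ^ #{d ∈ A | d < s} * z ^ #{d ∈ A | s < d ∧ l < d} =
      z ^ (highLabel π + 1) * ∑ i ∈ range (lowLabel π + 1), y ^ i := by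
    rw [← hL, ← sum_card_filter_lt, mul_sum]
    refine sum_congr rfl fun s hs => ?_
    rw [mem_filter] at hs
    rw [← hK, mul_comm, filter_filter]
    congr 3 <;> ext d <;> simp only [mem_filter] <;> grind
  have hhigh : ∑ s ∈ A with ¬ s ≤ l, y ^ #{d ∈ A | d < s} * z ^ #{d ∈ A | s < d ∧ l < d} =
      y ^ (lowLabel π + 1) *
        ∑ i ∈ range (highLabel π + 1), y ^ i * z ^ (highLabel π + 1 - 1 - i) := by
    rw [← hK, ← sum_card_filter_lt
      (f := fun i => y ^ i * z ^ (#{c ∈ A | l < c} - 1 - i)), mul_sum]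
    simp only [not_le]
    refine sum_congr rfl fun s hs => ?_
    have hs' := mem_filter.1 hs
    rw [← mul_assoc, ← pow_add, ← hL]
    congr 2
    · rw [← card_union_of_disjoint]
      · congr 1
        ext d
        simp only [mem_filter, mem_union]
        grind
      · rw [disjoint_left]
        intro d
        simp only [mem_filter]
        grind
    · have : #{c ∈ A | l < c} =
          #{d ∈ A | s < d ∧ l < d} + #{c ∈ ({c ∈ A | l < c} : Finset ℕ) | c < s} + 1 := by
        rw [← card_union_of_disjoint, ← card_insert_of_notMem (a := s)]
        · congr 1
          ext d
          simp only [mem_filter, mem_union, mem_insert]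
          grind
        · simp
        · rw [disjoint_left]
          intro d
          simp only [mem_filter]
          grind
      omega
  have g1 := mul_geom_sum y (lowLabel π + 1)
  have g2 := (Commute.all y z).mul_geom_sum₂ (highLabel π + 1)
  rw [show y - 1 = a by simp [y]] at g1
  rw [show y - z = - c by simp [y, z]] at g2
  rw [← sum_filter_add_sum_filter_not A (fun s => s ≤ l), hlow, hhigh]
  simp only [pow_add, pow_one] at *
  rw [show a = y - 1 by simp [y]] at *
  linear_combination (c * z ^ highLabel π * z) * g1 - (y - 1) * y ^ lowLabel π * y * g2

/-- The generating polynomial of the labels of semi-Baxter permutations of size `n + 1`. -/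
noncomputable def labelSum {R : Type*} [CommRing R] (n : ℕ) (y z : R) : R := by
  classical exact ∑ π : Equiv.Perm (Fin (n + 1)) with IsSemiBaxter π,
    y ^ lowLabel π * z ^ highLabel π

lemma labelSum_succ {R : Type*} [CommRing R] (n : ℕ) (a c : R) :
    a * c * labelSum (n + 1) (1 + a) (1 + a + c) =
      (a + c) * (1 + a) * (1 + a + c) * labelSum n (1 + a) (1 + a + c) -
        c * (1 + a + c) * labelSum n 1 (1 + a + c) -
        a * (1 + a) ^ 2 * labelSum n (1 + a) (1 + a) := by
  classical
  have key : labelSum (n + 1) (1 + a) (1 + a + c) =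
      ∑ π : Equiv.Perm (Fin (n + 1)) with IsSemiBaxter π, ∑ s ∈ activeSites π,
        (1 + a) ^ #{d ∈ activeSites π | d < s} *
        (1 + a + c) ^ #{d ∈ activeSites π | s < d ∧ (π (Fin.last n) : ℕ) < d} := by
    rw [labelSum, sum_filter, ← (appendLast_bijective (n + 1)).sum_comp, Fintype.sum_prod_type,
      sum_comm, sum_filter]
    refine sum_congr rfl fun π _ => ?_
    by_cases h : IsSemiBaxter π
    · have hA : activeSites π = (range (n + 1 + 1)).filter (· ∈ activeSites π) := by
        ext c
        simp only [mem_filter, mem_range]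
        exact ⟨fun h => ⟨(mem_activeSites.1 h).1, h⟩, fun h => h.2⟩
      rw [if_pos h]
      conv_rhs => rw [hA, sum_filter, sum_range]
      refine sum_congr rfl fun s _ => ?_
      simp only [isSemiBaxter_appendLast, h, true_and]
      split_ifs with hs
      · rw [lowLabel_appendLast hs, highLabel_appendLast hs, ← hA]
      · rfl
    · rw [if_neg h]
      simp [isSemiBaxter_appendLast, h]
  rw [key, mul_sum]
  rw [labelSum, labelSum, labelSum, mul_sum, mul_sum, mul_sum, ← sum_sub_distrib,
    ← sum_sub_distrib]
  refine sum_congr rfl fun π hπ => ?_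
  rw [sum_children (mem_filter.1 hπ).2]
  simp [pow_add]

lemma labelSum_zero {R : Type*} [CommRing R] (y z : R) : labelSum 0 y z = 1 := by
  classical
  have h : IsSemiBaxter (1 : Equiv.Perm (Fin (0 + 1))) := by
    rintro ⟨i, j, j', k, hij, -⟩
    omega
  have h1 : lowLabel (1 : Equiv.Perm (Fin (0 + 1))) = 0 := by
    simp [lowLabel]
  have h2 : highLabel (1 : Equiv.Perm (Fin (0 + 1))) = 0 := by
    rw [highLabel, card_eq_zero, filter_eq_empty_iff]
    intro c hc
    have := (mem_activeSites.1 hc).1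
    simp
    omega
  rw [labelSum, sum_filter, Fintype.sum_eq_single 1 fun π hπ => (hπ (by ext i; omega)).elim,
    if_pos h, h1, h2]
  simp

lemma semiBaxterCount_succ_eq_card (n : ℕ) [DecidablePred (IsSemiBaxter (n := n + 1))] :
    semiBaxterCount (n + 1) = #{π : Equiv.Perm (Fin (n + 1)) | IsSemiBaxter π} := by
  rw [semiBaxterCount, Nat.card_eq_fintype_card, Fintype.card_subtype]

end GeneratingTree

section KernelMethod

variable {R : Type*} [CommRing R]

lemma map_labelSum {S : Type*} [CommRing S] (f : R →+* S) (n : ℕ) (y z : R) :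
    f (labelSum n y z) = labelSum n (f y) (f z) := by
  simp [labelSum]

/-- The truncated series of the semi-Baxter generating polynomials on the diagonal. -/
noncomputable def diagSeries (x : R) (N : ℕ) (a : R) : R :=
  ∑ m ∈ range N, x ^ (m + 1) * ((1 + a) ^ 2 * labelSum m (1 + a) (1 + a))

/-- The truncated series of the semi-Baxter generating polynomials with first variable `1`. -/
noncomputable def sideSeries (x : R) (N : ℕ) (b : R) : R :=
  ∑ m ∈ range N, x ^ (m + 1) * ((1 + b) * labelSum m 1 (1 + b))

lemma kernel_identity {x a c : R} (h : a * c = x * ((1 + a) * (1 + a + c) * (a + c))) (N : ℕ) :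
    ∃ e, c * sideSeries x N (a + c) + a * diagSeries x N a = a * c * (1 - x ^ N * e) := by
  refine ⟨labelSum N (1 + a) (1 + a + c), ?_⟩
  induction N with
  | zero => simp [sideSeries, diagSeries, labelSum_zero]
  | succ N ih =>
    rw [sideSeries, diagSeries, sum_range_succ, sum_range_succ, ← sideSeries, ← diagSeries,
      ← add_assoc]
    linear_combination ih + x ^ (N + 1) * labelSum_succ N a c -
      x ^ N * labelSum N (1 + a) (1 + a + c) * h

lemma diagSeries_eq [IsDomain R] {x a A V D : R} (hA : a * A = 1) (hD : (1 + V) * D = 1)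
    (hV0 : V ≠ 0) (hV : V = x * (A * (1 + a) * (1 + V) * (a + (1 + a) * V))) (N : ℕ) :
    ∃ E : R, diagSeries x N a =
      (1 + a) * V - A * (1 + a) * V ^ 2 + x * (A ^ 4 * (1 + a) ^ 2 * (a + (1 + a) * V) * V ^ 2)
        - x ^ 2 * (A ^ 6 * (1 + a) ^ 3 * (a + (1 + a) * V) ^ 2 * V)
        + x ^ 2 * (A ^ 6 * (1 + a) ^ 3 * (a + (1 + a) * V))
        - x * (A ^ 4 * (1 + a) ^ 2 * sideSeries x N A) + x ^ N * E := by
  have hVD : V * D = x * (A * (1 + a) * (a + (1 + a) * V)) := by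
    linear_combination D * hV + x * (A * (1 + a) * (a + (1 + a) * V)) * hD
  have haV : a * V = x * ((1 + a) * (1 + V) * (a + (1 + a) * V)) := by
    linear_combination a * hV + x * ((1 + a) * (1 + V) * (a + (1 + a) * V)) * hA
  have hVA : 1 + V * A * D = A * D * (a + (1 + a) * V) := by
    linear_combination - hA - a * A * hD
  have hA0 : A ≠ 0 := right_ne_zero_of_mul_eq_one hA
  have hD0 : D ≠ 0 := right_ne_zero_of_mul_eq_one hD
  obtain ⟨e1, k1⟩ := kernel_identity (x := x) (a := a) (c := (1 + a) * V)
    (by linear_combination (1 + a) * haV) N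
  obtain ⟨e2, k2⟩ := kernel_identity (x := x) (a := V) (c := a * (1 + V))
    (by linear_combination (1 + V) * haV) N
  obtain ⟨e3, k3⟩ := kernel_identity (x := x) (a := V) (c := V * A)
    (by
      rw [show V + V * A = V * A * (1 + a) by linear_combination - V * hA,
        show 1 + V + V * A = A * (a + (1 + a) * V) by linear_combination (-1 - V) * hA]
      linear_combination V * A * hV) N
  obtain ⟨e4, k4⟩ := kernel_identity (x := x) (a := V * A * D) (c := (a + (1 + a) * V) * (V * A * D))
    (by
      rw [show V * A * D + (a + (1 + a) * V) * (V * A * D) = V * A * (1 + a) by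
          linear_combination V * A * (1 + a) * hD,
        show 1 + V * A * D + (a + (1 + a) * V) * (V * A * D) = A * (a + (1 + a) * V) by
          linear_combination V * A * (1 + a) * hD - hA, hVA]
      linear_combination V * A ^ 2 * D * (a + (1 + a) * V) * hVD) N
  obtain ⟨e5, k5⟩ := kernel_identity (x := x) (a := V * A * D) (c := A * D)
    (by
      rw [show 1 + V * A * D + A * D = A * (1 + a) by linear_combination A * hD - hA, hVA,
        show V * A * D + A * D = A by linear_combination A * hD]
      linear_combination A ^ 2 * D * hVD) N
  rw [show V + a * (1 + V) = a + (1 + a) * V by ring] at k2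
  rw [show V + V * A = V * A * (1 + a) by linear_combination - V * hA] at k3
  rw [show V * A * D + (a + (1 + a) * V) * (V * A * D) = V * A * (1 + a) by
    linear_combination V * A * (1 + a) * hD] at k4
  rw [show V * A * D + A * D = A by linear_combination A * hD] at k5
  generalize sideSeries x N (a + (1 + a) * V) = R1 at *
  generalize sideSeries x N (V * A * (1 + a)) = R3 at *
  generalize sideSeries x N A = R5 at *
  generalize diagSeries x N a = T1 at *
  generalize diagSeries x N V = T2 at *
  generalize diagSeries x N (V * A * D) = T4 at *
  have k3' : A * R3 + T2 = V * A * (1 - x ^ N * e3) :=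
    mul_left_cancel₀ hV0 (by linear_combination k3)
  have k4' : (a + (1 + a) * V) * R3 + T4 =
      (a + (1 + a) * V) * (V * A * D) * (1 - x ^ N * e4) :=
    mul_left_cancel₀ (mul_ne_zero (mul_ne_zero hV0 hA0) hD0) (by linear_combination k4)
  have k5' : R5 + V * T4 = V * A * D * (1 - x ^ N * e5) :=
    mul_left_cancel₀ (mul_ne_zero hA0 hD0) (by linear_combination k5)
  have k2' : R1 + V * A * D * T2 = V * (1 - x ^ N * e2) := by
    linear_combination A * D * k2 + (- R1 + V * (1 - x ^ N * e2)) * hD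
      + (1 + V) * D * (- R1 + V * (1 - x ^ N * e2)) * hA
  have k1' : (1 + a) * V * A * R1 + T1 = (1 + a) * V * (1 - x ^ N * e1) := by
    linear_combination A * k1 + (- T1 + (1 + a) * V * (1 - x ^ N * e1)) * hA
  refine ⟨- ((1 + a) * V) * e1 + (1 + a) * A * V ^ 2 * e2
    - (1 + a) * V ^ 3 * A ^ 3 * D * e3
    + x * (A ^ 4 * (1 + a) ^ 2 * V * ((a + (1 + a) * V) * (V * A * D))) * e4
    - x * (A ^ 4 * (1 + a) ^ 2 * (V * A * D)) * e5, ?_⟩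
  have hT1 : T1 = (1 + a) * V * (1 - x ^ N * e1) - (1 + a) * V * A * V * (1 - x ^ N * e2)
      + (1 + a) * V * A * (V * A * D) * (V * A * (1 - x ^ N * e3))
      - (1 + a) * V * A * A * A * (V * D) * R3 := by
    linear_combination k1' - (1 + a) * V * A * k2' + (1 + a) * V * A * (V * A * D) * k3'
  rw [hT1]
  linear_combination ((1 + a) * V ^ 2 * A ^ 3 - (1 + a) * V * A ^ 3 * R3
      - x * ((1 + a) ^ 2 * A ^ 5 * V * (a + (1 + a) * V)) + x * ((1 + a) ^ 2 * A ^ 5)) * hVD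
    - x * ((1 + a) ^ 2 * A ^ 4 * V) * k4' + x * ((1 + a) ^ 2 * A ^ 4) * k5'

end KernelMethod

section LagrangeInversion

open PowerSeries in
lemma exists_eq_X_mul_eval {L : Type*} [CommRing L] (φ : Polynomial L⟦X⟧) :
    ∃ V : L⟦X⟧, V = X * φ.eval V := by
  let v : ℕ → L⟦X⟧ := fun n => Nat.rec 0 (fun _ w => X * φ.eval w) n
  have hv : ∀ n, v (n + 1) = X * φ.eval (v n) := fun n => rfl
  have step : ∀ n, X ^ n ∣ v (n + 1) - v n := by
    intro n
    induction n with
    | zero => simp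
    | succ n ih =>
      rw [hv (n + 1), hv n, ← mul_sub, pow_succ']
      exact mul_dvd_mul_left X (ih.trans (Polynomial.sub_dvd_eval_sub _ _ _))
  have far : ∀ m k, X ^ m ∣ v (m + k) - v m := by
    intro m k
    induction k with
    | zero => simp
    | succ k ih =>
      have h := dvd_add ((pow_dvd_pow X (Nat.le_add_right m k)).trans (step (m + k))) ih
      rwa [sub_add_sub_cancel] at h
  let V : L⟦X⟧ := PowerSeries.mk fun i => coeff i (v (i + 1))
  have hV : ∀ n, X ^ n ∣ V - v n := by
    intro n
    rw [X_pow_dvd_iff]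
    intro i hi
    obtain ⟨k, rfl⟩ := Nat.exists_eq_add_of_le (Nat.succ_le_of_lt hi)
    have := X_pow_dvd_iff.1 (far (i + 1) k) i (Nat.lt_succ_self i)
    rw [map_sub] at this ⊢
    rw [coeff_mk, ← neg_sub, this, neg_zero]
  refine ⟨V, sub_eq_zero.1 (PowerSeries.ext fun n => ?_)⟩
  have h : X ^ (n + 1) ∣ V - X * φ.eval V := by
    have h1 := hV (n + 2)
    have h2 := (hV (n + 1)).trans (Polynomial.sub_dvd_eval_sub V (v (n + 1)) φ)
    rw [hv (n + 1)] at h1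
    have h3 := dvd_sub ((pow_dvd_pow X (Nat.le_succ _)).trans h1) (h2.mul_left X)
    convert h3 using 1
    ring
  rw [X_pow_dvd_iff.1 h n (Nat.lt_succ_self n), map_zero]

open PowerSeries in
/-- Lagrange inversion for a polynomial `φ`. -/
lemma lagrange_inversion {L : Type*} [CommRing L] [IsDomain L] [CharZero L] {φ : Polynomial L}
    {V : L⟦X⟧} (hV : V = X * Polynomial.aeval V φ) :
    ∀ n k : ℕ, k ≤ n → (n : L) * coeff n (V ^ k) = k * (φ ^ n).coeff (n - k) := by
  have hlow : ∀ n k : ℕ, n < k → coeff n (V ^ k) = 0 := fun n k h =>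
    X_pow_dvd_iff.1 (pow_dvd_pow_of_dvd (Dvd.intro _ hV.symm) k) n h
  have hrec : ∀ n k : ℕ, k ≤ n → coeff (n + 1) (V ^ (k + 1)) =
      ∑ i ∈ range (n - k + 1), φ.coeff i * coeff n (V ^ (k + i)) := by
    intro n k hk
    have h1 : V ^ (k + 1) = X * (V ^ k * Polynomial.aeval V φ) := by
      rw [pow_succ]
      nth_rewrite 2 [hV]
      ring
    rw [h1, coeff_succ_X_mul,
      Polynomial.aeval_eq_sum_range' (n := φ.natDegree + 1 + (n - k + 1)) (by omega),
      mul_sum, map_sum]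
    simp only [mul_smul_comm, ← pow_add, map_smul, smul_eq_mul]
    refine (sum_subset (range_mono (by omega)) fun i _ hi => ?_).symm
    rw [hlow _ _ (by simp at hi; omega), mul_zero]
  intro n
  induction n with
  | zero => simp
  | succ n ih =>
    rintro (_ | k) hk
    · simp [coeff_one]
    · rw [hrec n k (by omega), Nat.add_sub_add_right]
      rcases Nat.eq_zero_or_pos n with rfl | hn
      · obtain rfl : k = 0 := by omega
        simp
      · obtain ⟨M, rfl⟩ := Nat.exists_eq_add_of_le (Nat.le_of_succ_le_succ hk)
        rw [Nat.add_sub_cancel_left]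
        have hn0 : ((k + M : ℕ) : L) ≠ 0 := Nat.cast_ne_zero.2 (by omega)
        refine mul_left_cancel₀ hn0 ?_
        have e1 : ((k + M : ℕ) : L) * ∑ i ∈ range (M + 1),
            φ.coeff i * coeff (k + M) (V ^ (k + i)) =
            ∑ i ∈ range (M + 1), (k * (φ.coeff i * (φ ^ (k + M)).coeff (M - i)) +
              (i * φ.coeff i) * (φ ^ (k + M)).coeff (M - i)) := by
          rw [mul_sum]
          refine sum_congr rfl fun i hi => ?_
          have := ih (k + i) (by simp at hi; omega)
          rw [show k + M - (k + i) = M - i by omega] at this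
          push_cast at this ⊢
          linear_combination φ.coeff i * this
        have e2 : ∑ i ∈ range (M + 1), φ.coeff i * (φ ^ (k + M)).coeff (M - i) =
            (φ ^ (k + M + 1)).coeff M := by
          rw [pow_succ', Polynomial.coeff_mul, Finset.Nat.sum_antidiagonal_eq_sum_range_succ_mk]
        have e3 : ((k + M + 1 : ℕ) : L) * ∑ i ∈ range (M + 1),
            (i * φ.coeff i) * (φ ^ (k + M)).coeff (M - i) =
            M * (φ ^ (k + M + 1)).coeff M := by
          have hX : ∀ (p : Polynomial L) (i : ℕ),
              (Polynomial.X * Polynomial.derivative p).coeff i = i * p.coeff i := by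
            rintro p (_ | i)
            · simp
            · rw [Polynomial.coeff_X_mul, Polynomial.coeff_derivative]
              push_cast
              ring
          rw [← hX, Polynomial.derivative_pow_succ,
            show Polynomial.X * (Polynomial.C ((k + M : ℕ) + 1 : L) * φ ^ (k + M) *
              Polynomial.derivative φ) = Polynomial.C ((k + M : ℕ) + 1 : L) *
              ((Polynomial.X * Polynomial.derivative φ) * φ ^ (k + M)) by ring,
            Polynomial.coeff_C_mul, Polynomial.coeff_mul (Polynomial.X * _),
            Finset.Nat.sum_antidiagonal_eq_sum_range_succ_mk]
          simp only [hX]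
          push_cast
          ring
        rw [mul_left_comm, e1, sum_add_distrib, ← mul_sum, e2, mul_add, e3]
        push_cast
        ring

end LagrangeInversion

section ConstantTerm

open LaurentPolynomial hiding C

/-- The constant term of a Laurent polynomial. -/
noncomputable def constTerm : ℚ[T;T⁻¹] →+ ℚ where
  toFun f := f.coeff 0
  map_zero' := rfl
  map_add' _ _ := rfl

lemma constTerm_T (m : ℤ) : constTerm (T m) = if m = 0 then 1 else 0 := T_apply 0 m

lemma constTerm_natCast_mul (c : ℕ) (f : ℚ[T;T⁻¹]) :
    constTerm (c * f) = c * constTerm f := by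
  rw [← nsmul_eq_mul, map_nsmul, nsmul_eq_mul]

lemma constTerm_T_mul_pow (m s : ℕ) :
    constTerm (T (-1) ^ s * (1 + T 1) ^ m) = m.choose s := by
  rw [add_comm 1 (T 1), add_pow, mul_sum, map_sum]
  have : ∀ i : ℕ, constTerm (T (-1) ^ s * (T 1 ^ i * 1 ^ (m - i) * (m.choose i : ℚ[T;T⁻¹]))) =
      if i = s then (m.choose i : ℚ) else 0 := by
    intro i
    rw [one_pow, mul_one, ← mul_assoc, mul_comm, constTerm_natCast_mul, T_pow, T_pow, ← T_add,
      constTerm_T]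
    split_ifs <;> first | omega | simp
  simp only [this]
  rw [sum_ite_eq' (range (m + 1)) s]
  split_ifs with h
  · rfl
  · rw [Nat.choose_eq_zero_of_lt (by simpa using h), Nat.cast_zero]

lemma constTerm_one_add_pow (m : ℕ) : constTerm ((1 + T 1) ^ m) = 1 := by
  simpa using constTerm_T_mul_pow m 0

lemma constTerm_sq_mul_pow (m : ℕ) : constTerm (T (-1) ^ 2 * (1 + T (-1)) ^ m) = 0 := by
  rw [add_comm 1 (T (-1)), add_pow, mul_sum, map_sum]
  refine sum_eq_zero fun i _ => ?_
  rw [one_pow, mul_one, ← mul_assoc, mul_comm, constTerm_natCast_mul, T_pow, T_pow, ← T_add,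
    constTerm_T, if_neg (by push_cast; omega), mul_zero]

lemma T_one_mul_T_neg_one : (T 1 * T (-1) : ℚ[T;T⁻¹]) = 1 := by
  rw [← T_add]; simp

instance : CharZero ℚ[T;T⁻¹] :=
  charZero_of_injective_algebraMap (algebraMap ℚ ℚ[T;T⁻¹]).injective

/-- The polynomial `φ` for which the kernel is annihilated by the series `V = X φ(V)`. -/
noncomputable def kernelPoly : Polynomial ℚ[T;T⁻¹] :=
  Polynomial.C (T (-1) * (1 + T 1)) * (1 + Polynomial.X) *
    (Polynomial.C (T 1) + Polynomial.C (1 + T 1) * Polynomial.X)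

lemma coeff_C_add_C_mul_X_pow {L : Type*} [CommRing L] (a b : L) (n j : ℕ) :
    ((Polynomial.C a + Polynomial.C b * Polynomial.X) ^ n).coeff j =
      n.choose j * (b ^ j * a ^ (n - j)) := by
  rw [add_comm, add_pow, Polynomial.finsetSum_coeff]
  have : ∀ i, ((Polynomial.C b * Polynomial.X) ^ i * Polynomial.C a ^ (n - i) *
      (n.choose i : Polynomial L)).coeff j =
      if j = i then n.choose i * (b ^ i * a ^ (n - i)) else 0 := by
    intro i
    rw [show (Polynomial.C b * Polynomial.X) ^ i * Polynomial.C a ^ (n - i) *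
      (n.choose i : Polynomial L) =
      Polynomial.C (n.choose i * (b ^ i * a ^ (n - i))) * Polynomial.X ^ i by
        simp only [map_mul, map_pow, map_natCast]; ring, Polynomial.coeff_C_mul_X_pow]
  simp only [this]
  rw [sum_ite_eq]
  split_ifs with h
  · rfl
  · rw [Nat.choose_eq_zero_of_lt (by simpa using h), Nat.cast_zero, zero_mul]

lemma coeff_kernelPoly_pow {n k : ℕ} (hk : k ≤ n) :
    (kernelPoly ^ n).coeff (n - k) = ∑ j ∈ range (n + 1),
      ((n.choose j * n.choose (j + k) : ℕ) : ℚ[T;T⁻¹]) *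
        (T (-1) ^ j * (1 + T 1) ^ (n + j)) := by
  rw [kernelPoly, mul_assoc, mul_pow, mul_pow, ← Polynomial.C_pow, Polynomial.coeff_C_mul,
    mul_comm ((1 + Polynomial.X) ^ n), Polynomial.coeff_mul,
    Finset.Nat.sum_antidiagonal_eq_sum_range_succ_mk, mul_sum]
  refine (sum_congr rfl fun j hj => ?_).trans
    (sum_subset (range_mono (show n - k + 1 ≤ n + 1 by omega)) fun j _ hj => ?_)
  · have hj' : j ≤ n - k := by simpa [Nat.lt_succ_iff] using hj
    rw [coeff_C_add_C_mul_X_pow, Polynomial.coeff_one_add_X_pow,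
      ← Nat.choose_symm (n := n) (k := n - k - j) (by omega),
      show n - (n - k - j) = j + k by omega]
    obtain ⟨i, rfl⟩ := Nat.exists_eq_add_of_le (show j ≤ n by omega)
    rw [Nat.add_sub_cancel_left, mul_pow, pow_add (T (-1))]
    have h : (T (-1) ^ i * T 1 ^ i : ℚ[T;T⁻¹]) = 1 := by
      rw [← mul_pow, mul_comm, T_one_mul_T_neg_one, one_pow]
    push_cast
    linear_combination ((j + i).choose j * (j + i).choose (j + k) : ℚ[T;T⁻¹]) * T (-1) ^ j *
      (1 + T 1) ^ (j + i + j) * h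
  · rw [Nat.choose_eq_zero_of_lt (show n < j + k by simp at hj; omega)]
    simp

open PowerSeries in
lemma exists_kernel_root : ∃ V : ℚ[T;T⁻¹]⟦X⟧, V = X * Polynomial.aeval V kernelPoly := by
  obtain ⟨V, hV⟩ := exists_eq_X_mul_eval (kernelPoly.map (C (R := ℚ[T;T⁻¹])))
  refine ⟨V, hV.trans ?_⟩
  rw [Polynomial.aeval_def, Polynomial.eval₂_eq_eval_map]
  rfl

/-- The binomial sums appearing as constant terms of coefficients of powers of `V`. -/
def binomSum (n k s e : ℕ) : ℚ :=
  ∑ j ∈ range (n + 1), n.choose j * n.choose (j + k) * (n + j + e).choose (j + s)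

open PowerSeries in
lemma constTerm_coeff_pow {V : ℚ[T;T⁻¹]⟦X⟧} (hV : V = X * Polynomial.aeval V kernelPoly)
    (n k s e : ℕ) (hk : k ≠ 0) :
    constTerm (T (-1) ^ s * (1 + T 1) ^ e * coeff n (V ^ k)) = k / n * binomSum n k s e := by
  have hlow : ∀ n k : ℕ, n < k → coeff n (V ^ k) = 0 := fun n k h =>
    X_pow_dvd_iff.1 (pow_dvd_pow_of_dvd (Dvd.intro _ hV.symm) k) n h
  rcases Nat.eq_zero_or_pos n with rfl | hn
  · rw [hlow 0 k (by omega)]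
    simp
  · have hn0 : (n : ℚ) ≠ 0 := by positivity
    rw [div_mul_eq_mul_div, eq_div_iff hn0, mul_comm, ← constTerm_natCast_mul]
    rcases lt_or_ge n k with h | h
    · rw [hlow n k h, mul_zero, mul_zero, map_zero, binomSum, sum_eq_zero, mul_zero]
      intro j _
      rw [Nat.choose_eq_zero_of_lt (show n < j + k by omega)]
      simp
    · rw [mul_left_comm, lagrange_inversion hV n k h, coeff_kernelPoly_pow h, mul_left_comm,
        constTerm_natCast_mul, binomSum, mul_sum, map_sum]
      congr 1
      refine sum_congr rfl fun j _ => ?_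
      rw [mul_left_comm, constTerm_natCast_mul, show (T (-1) ^ s * (1 + T 1) ^ e *
        (T (-1) ^ j * (1 + T 1) ^ (n + j)) : ℚ[T;T⁻¹]) =
        T (-1) ^ (j + s) * (1 + T 1) ^ (n + j + e) by ring, constTerm_T_mul_pow]
      push_cast
      ring

open PowerSeries in
lemma coeff_sum_X_pow_mul_C {L : Type*} [CommRing L] (r : ℕ → L) {m N : ℕ} (h : m < N) :
    coeff (m + 1) (∑ p ∈ range N, (X : L⟦X⟧) ^ (p + 1) * C (r p)) = r m := by
  rw [map_sum, sum_eq_single m]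
  · simp
  · intro p _ hp
    rw [coeff_X_pow_mul']
    split_ifs with h'
    · rw [coeff_C, if_neg (by omega)]
    · rfl
  · intro h'
    simp at h'
    omega

open PowerSeries in
lemma constTerm_coeff_diagSeries (n N : ℕ) (h : n < N) :
    constTerm (coeff (n + 1) (diagSeries (X : ℚ[T;T⁻¹]⟦X⟧) N (C (T 1)))) =
      semiBaxterCount (n + 1) := by
  classical
  have h1 : ∀ p, (1 + C (T 1 : ℚ[T;T⁻¹])) ^ 2 *
      labelSum p (1 + C (T 1 : ℚ[T;T⁻¹])) (1 + C (T 1 : ℚ[T;T⁻¹])) =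
      C ((1 + T 1) ^ 2 * labelSum p (1 + T 1) (1 + T 1)) := by
    intro p
    rw [map_mul, map_labelSum]
    simp
  simp only [diagSeries, h1]
  rw [coeff_sum_X_pow_mul_C _ h, labelSum, mul_sum, map_sum, semiBaxterCount_succ_eq_card]
  simp only [← pow_add, constTerm_one_add_pow]
  simp

open PowerSeries in
lemma constTerm_coeff_sideSeries (n N : ℕ) (h : n < N) :
    constTerm (T (-1) ^ 4 * (1 + T 1) ^ 2 *
      coeff (n + 1) (sideSeries (X : ℚ[T;T⁻¹]⟦X⟧) N (C (T (-1))))) = 0 := by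
  classical
  have h1 : ∀ p, (1 + C (T (-1) : ℚ[T;T⁻¹])) *
      labelSum p 1 (1 + C (T (-1) : ℚ[T;T⁻¹])) =
      C ((1 + T (-1)) * labelSum p 1 (1 + T (-1))) := by
    intro p
    rw [map_mul, map_labelSum]
    simp
  simp only [sideSeries, h1]
  rw [coeff_sum_X_pow_mul_C _ h, labelSum, mul_sum, mul_sum, map_sum]
  refine sum_eq_zero fun π _ => ?_
  rw [← constTerm_sq_mul_pow (highLabel π + 3)]
  refine congrArg constTerm ?_
  have hT := T_one_mul_T_neg_one
  have h2 : (T (-1) * (1 + T 1) : ℚ[T;T⁻¹]) = 1 + T (-1) := by linear_combination hT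
  rw [one_pow, one_mul, show (T (-1) ^ 4 * (1 + T 1) ^ 2 : ℚ[T;T⁻¹]) =
    T (-1) ^ 2 * (T (-1) * (1 + T 1)) ^ 2 by ring, h2]
  ring

open PowerSeries in
lemma semiBaxterCount_eq_binomSum (m : ℕ) :
    (semiBaxterCount (m + 2) : ℚ) =
      1 / (m + 2) * binomSum (m + 2) 1 0 1 - 2 / (m + 2) * binomSum (m + 2) 2 1 1
      + 2 / (m + 1) * binomSum (m + 1) 2 3 2 + 3 / (m + 1) * binomSum (m + 1) 3 4 3
      - 1 / m * binomSum m 1 4 3 - 4 / m * binomSum m 2 5 4 - 3 / m * binomSum m 3 6 5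
      + 1 / m * binomSum m 1 6 4 := by
  obtain ⟨V, hV⟩ := exists_kernel_root
  have hV' : V = X * (C (T (-1)) * (1 + C (T 1)) * (1 + V) * (C (T 1) + (1 + C (T 1)) * V)) := by
    nth_rewrite 1 [hV]
    simp only [kernelPoly, map_mul, map_add, map_one, Polynomial.aeval_C, Polynomial.aeval_X,
      PowerSeries.algebraMap_eq]
  have hT : (C (T 1 : ℚ[T;T⁻¹]) * C (T (-1))) = 1 := by
    rw [← map_mul, T_one_mul_T_neg_one, map_one]
  have hV0 : V ≠ 0 := by
    rintro rfl
    have h1 : (X : ℚ[T;T⁻¹]⟦X⟧) * C (1 + T 1) = 0 := by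
      rw [map_add, map_one]
      linear_combination -hV' - X * (1 + C (T 1)) * hT
    have h2 := congrArg constTerm (congrArg (coeff 1) h1)
    rw [show (1 : ℕ) = 0 + 1 from rfl, coeff_succ_X_mul] at h2
    have h3 := constTerm_one_add_pow 1
    rw [pow_one] at h3
    simp only [coeff_zero_C, map_zero, h3] at h2
    exact one_ne_zero h2
  obtain ⟨D, hD⟩ : ∃ D, (1 + V) * D = 1 := by
    refine IsUnit.exists_right_inv (isUnit_iff_constantCoeff.2 ?_)
    rw [hV]
    simp
  obtain ⟨E, hE⟩ := diagSeries_eq hT hD hV0 hV' (m + 3)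
  have key : diagSeries X (m + 3) (C (T 1)) =
      C (T (-1) ^ 0 * (1 + T 1) ^ 1) * V - C (T (-1) * (1 + T 1)) * V ^ 2
      + X ^ 1 * (C (T (-1) ^ 3 * (1 + T 1) ^ 2) * V ^ 2)
      + X ^ 1 * (C (T (-1) ^ 4 * (1 + T 1) ^ 3) * V ^ 3)
      - X ^ 2 * (C (T (-1) ^ 4 * (1 + T 1) ^ 3) * V)
      - X ^ 2 * (C (2 * (T (-1) ^ 5 * (1 + T 1) ^ 4)) * V ^ 2)
      - X ^ 2 * (C (T (-1) ^ 6 * (1 + T 1) ^ 5) * V ^ 3)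
      + X ^ 2 * C (T (-1) ^ 5 * (1 + T 1) ^ 3)
      + X ^ 2 * (C (T (-1) ^ 6 * (1 + T 1) ^ 4) * V)
      - X ^ 1 * (C (T (-1) ^ 4 * (1 + T 1) ^ 2) * sideSeries X (m + 3) (C (T (-1))))
      + X ^ (m + 3) * E := by
    rw [hE]
    simp only [map_mul, map_pow, map_add, map_one, map_ofNat]
    generalize C (T 1 : ℚ[T;T⁻¹]) = a at *
    generalize C (T (-1) : ℚ[T;T⁻¹]) = A at *
    linear_combination (X * A ^ 3 * (1 + a) ^ 2 * V ^ 2 - X ^ 2 * (1 + a) ^ 3 * V * A ^ 4 * (a * A + 1)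
      - 2 * X ^ 2 * (1 + a) ^ 4 * A ^ 5 * V ^ 2 + X ^ 2 * A ^ 5 * (1 + a) ^ 3) * hT
  have h := congrArg constTerm (congrArg (coeff (m + 2)) key)
  rw [constTerm_coeff_diagSeries (m + 1) _ (by omega)] at h
  rw [h]
  have c0 : constTerm (coeff m (C (T (-1) ^ 5 * (1 + T 1) ^ 3 : ℚ[T;T⁻¹]))) = 0 := by
    rw [coeff_C]
    split_ifs
    · rw [constTerm_T_mul_pow]; rfl
    · rfl
  have d1 := constTerm_coeff_pow hV (m + 2) 1 0 1 (by simp)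
  have d2 := constTerm_coeff_pow hV (m + 2) 2 1 1 (by simp)
  have d3 := constTerm_coeff_pow hV (m + 1) 2 3 2 (by simp)
  have d4 := constTerm_coeff_pow hV (m + 1) 3 4 3 (by simp)
  have d5 := constTerm_coeff_pow hV m 1 4 3 (by simp)
  have d6 := constTerm_coeff_pow hV m 2 5 4 (by simp)
  have d7 := constTerm_coeff_pow hV m 3 6 5 (by simp)
  have d8 := constTerm_coeff_pow hV m 1 6 4 (by simp)
  have d9 := constTerm_coeff_sideSeries m (m + 3) (by omega)
  have d6' := constTerm_natCast_mul 2 (T (-1) ^ 5 * (1 + T 1) ^ 4 * coeff m (V ^ 2))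
  rw [d6, ← mul_assoc] at d6'
  simp only [pow_one] at d1 d2 d5 d8
  rw [← pow_one (1 + T 1)] at d1
  push_cast at *
  simp only [map_add, map_sub, coeff_X_pow_mul', coeff_C_mul,
    show 1 ≤ m + 2 by omega, show 2 ≤ m + 2 by omega, show ¬ (m + 3 ≤ m + 2) by omega, if_true,
    if_false, show m + 2 - 1 = m + 1 by omega, show m + 2 - 2 = m by omega, c0, map_zero]
  simp only [d1, d2, d3, d4, d5, d6', d7, d8, d9]
  ring

end ConstantTerm

section BinomialIdentity

/-- The factorial, extended to the integers by `0! = 1` at negative arguments. -/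
def intFact (z : ℤ) : ℚ := (z.toNat).factorial

/-- The reciprocal of the factorial, extended to the integers by zero. -/
def invFact (z : ℤ) : ℚ := if z < 0 then 0 else ((z.toNat).factorial : ℚ)⁻¹

lemma intFact_add_one {z : ℤ} (hz : 0 ≤ z) : intFact (z + 1) = (z + 1) * intFact z := by
  lift z to ℕ using hz
  rw [intFact, intFact, ← Nat.cast_succ, Int.toNat_natCast, Int.toNat_natCast, Nat.factorial_succ]
  push_cast
  rfl

lemma invFact_sub_one (z : ℤ) : invFact (z - 1) = z * invFact z := by
  rcases lt_or_ge z 0 with hz | hz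
  · rw [invFact, invFact, if_pos hz, if_pos (by omega), mul_zero]
  · lift z to ℕ using hz
    rcases z with _ | z
    · simp [invFact]
    · have h : ((z + 1 : ℕ) : ℤ) - 1 = z := by push_cast; ring
      rw [h, invFact, invFact, if_neg (by omega), if_neg (by omega), Int.toNat_natCast,
        Int.toNat_natCast, Nat.factorial_succ]
      push_cast
      field_simp

lemma invFact_natCast (n : ℕ) : invFact n = (n.factorial : ℚ)⁻¹ := by
  rw [invFact, if_neg (by omega), Int.toNat_natCast]

lemma invFact_of_neg {z : ℤ} (hz : z < 0) : invFact z = 0 := if_pos hz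

lemma choose_eq_invFact {n r : ℕ} {p q s : ℤ} (hp : p = n) (hq : q = r) (hs : s = n - r) :
    (n.choose r : ℚ) = intFact p * invFact q * invFact s := by
  subst hp hq hs
  rcases lt_or_ge n r with h | h
  · rw [Nat.choose_eq_zero_of_lt h, invFact_of_neg (z := n - r) (by omega), mul_zero, Nat.cast_zero]
  · rw [Nat.cast_choose ℚ h, ← Nat.cast_sub h, invFact_natCast, invFact_natCast, intFact,
      Int.toNat_natCast]
    field_simp

lemma binomSum_eq_sum_invFact {n m k s e : ℕ} (a : ℕ) (q p₁ p₂ p₃ p₄ p₅ p₆ : ℤ)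
    (hk : m + a + 1 = n + k) (hq : q = m - n) (h₁ : p₁ = -a) (h₂ : p₂ = k - a) (h₃ : p₃ = s - a)
    (h₄ : p₄ = k - 1) (h₅ : p₅ = q + e - a) (h₆ : p₆ = q + e - s) :
    binomSum m k s e = ∑ j ∈ range n, intFact (n + q) ^ 2 * invFact (n + p₆) *
      intFact (n + j + p₅) * (invFact (j + p₁) * invFact (j + p₂) * invFact (j + p₃)) *
      (invFact (n - j - 1) * invFact (n - j + p₄)) := by
  rcases lt_or_ge n a with h | h
  · rw [binomSum, sum_eq_zero, sum_eq_zero]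
    · intro j hj
      rw [invFact_of_neg (z := j + p₁) (by simp at hj; omega)]
      ring
    · intro j _
      rw [Nat.choose_eq_zero_of_lt (show m < j + k by omega)]
      simp
  · obtain ⟨l, rfl⟩ := Nat.exists_eq_add_of_le h
    rw [sum_range_add, sum_eq_zero, zero_add, binomSum]
    · refine ((sum_subset (range_mono (show l ≤ m + 1 by omega)) fun j _ hj => ?_).symm).trans
        (sum_congr rfl fun j hj => ?_)
      · rw [Nat.choose_eq_zero_of_lt (show m < j + k by simp at hj; omega)]
        simp
      · rw [choose_eq_invFact (p := (a + l : ℕ) + q) (q := (a + j : ℕ) + p₁)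
            (s := (a + l : ℕ) - (a + j : ℕ) + p₄) (by omega) (by omega) (by omega),
          choose_eq_invFact (p := (a + l : ℕ) + q) (q := (a + j : ℕ) + p₂)
            (s := (a + l : ℕ) - (a + j : ℕ) - 1) (by omega) (by omega) (by omega),
          choose_eq_invFact (p := (a + l : ℕ) + (a + j : ℕ) + p₅) (q := (a + j : ℕ) + p₃)
            (s := (a + l : ℕ) + p₆) (by omega) (by omega) (by omega)]
        ring
    · intro j hj
      rw [invFact_of_neg (z := j + p₁) (by simp at hj; omega)]
      ring

lemma sum_choose_eq_sum_invFact {n : ℕ} (hn : 1 ≤ n) :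
    (∑ j ∈ range (n + 1), n.choose (j + 2) * (n + 2).choose j * (n + j + 2).choose (j + 1) : ℚ) =
      ∑ j ∈ range n, intFact n * intFact (n + 2) * invFact (n + 1) * intFact (n + j + 1) *
        (invFact (j + -1) * invFact j * invFact (j + 1)) *
        (invFact (n - j - 1) * invFact (n - j + 3)) := by
  obtain ⟨l, rfl⟩ := Nat.exists_eq_add_of_le' hn
  rw [sum_range_succ' _ l, invFact_of_neg (z := (0 : ℕ) + -1) (by omega), zero_mul, zero_mul,
    mul_zero, zero_mul, add_zero]
  refine ((sum_subset (range_mono (show l ≤ l + 1 + 1 by omega)) fun j _ hj => ?_).symm).trans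
    (sum_congr rfl fun j hj => ?_)
  · rw [Nat.choose_eq_zero_of_lt (show l + 1 < j + 2 by simp at hj; omega)]
    simp
  · rw [choose_eq_invFact (p := (l + 1 : ℕ)) (q := (j + 1 : ℕ) + 1)
        (s := (l + 1 : ℕ) - (j + 1 : ℕ) - 1) (by omega) (by omega) (by omega),
      choose_eq_invFact (p := (l + 1 : ℕ) + 2) (q := (j + 1 : ℕ) + -1)
        (s := (l + 1 : ℕ) - (j + 1 : ℕ) + 3) (by omega) (by omega) (by omega),
      choose_eq_invFact (p := (l + 1 : ℕ) + (j + 1 : ℕ) + 1) (q := (j + 1 : ℕ))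
        (s := (l + 1 : ℕ) + 1) (by omega) (by omega) (by omega)]
    ring

/-- The polynomial part of the telescoping certificate. -/
def certPoly (n x : ℚ) : ℚ :=
  (4 * n ^ 7 + 46 * n ^ 6 + 216 * n ^ 5 + 272 * n ^ 4 - 640 * n ^ 3 - 726 * n ^ 2 + 612 * n + 216)
  + (16 * n ^ 7 + 135 * n ^ 6 + 320 * n ^ 5 + 150 * n ^ 4 + 52 * n ^ 3 - 517 * n ^ 2 - 516 * n
    + 360) * x
  + (2 * n ^ 7 + 5 * n ^ 6 + 24 * n ^ 5 + 221 * n ^ 4 + 385 * n ^ 3 + 72 * n ^ 2 - 643 * n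
    - 66) * x ^ 2
  + (2 * n ^ 7 + 9 * n ^ 6 - 20 * n ^ 5 - 172 * n ^ 4 - 122 * n ^ 3 + 447 * n ^ 2 + 216 * n
    - 360) * x ^ 3
  + (-3 * n ^ 6 - 12 * n ^ 5 + 10 * n ^ 4 + 66 * n ^ 3 + 57 * n ^ 2 + 38 * n - 156) * x ^ 4
  + (-2 * n ^ 4 - 8 * n ^ 3 - 2 * n ^ 2 + 12 * n) * x ^ 5
  + (n ^ 4 + 3 * n ^ 3 - 3 * n ^ 2 - 7 * n + 6) * x ^ 6

/-- The antidifference that telescopes the sum of all the summands. -/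
def certificate (n x : ℤ) : ℚ :=
  n ^ 2 * (n ^ 2 - 1) * x * certPoly n x / (n + 3) * intFact (n - 2) ^ 2 * invFact (n + 1) *
    intFact (n + x - 1) * (invFact (x - 1) * invFact x * invFact (x + 3)) *
    (invFact (n - x - 1) * invFact (n - x + 3))

set_option maxHeartbeats 4000000 in
lemma telescoping_identity {n x : ℤ} (hn : 3 ≤ n) (hx : 0 ≤ x) :
    (n - 1) * n ^ 2 * (n + 1) * (n + 2) * (
      1 / n * (intFact (n + 0) ^ 2 * invFact (n + 1) * intFact (n + x + 1) *
        (invFact (x + 0) * invFact (x + 1) * invFact (x + 0)) *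
        (invFact (n - x - 1) * invFact (n - x + 0)))
      - 2 / n * (intFact (n + 0) ^ 2 * invFact (n + 0) * intFact (n + x + 0) *
        (invFact (x + -1) * invFact (x + 1) * invFact (x + 0)) *
        (invFact (n - x - 1) * invFact (n - x + 1)))
      + 2 / (n - 1) * (intFact (n + -1) ^ 2 * invFact (n + -2) * intFact (n + x + -1) *
        (invFact (x + -2) * invFact (x + 0) * invFact (x + 1)) *
        (invFact (n - x - 1) * invFact (n - x + 1)))
      + 3 / (n - 1) * (intFact (n + -1) ^ 2 * invFact (n + -2) * intFact (n + x + -1) *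
        (invFact (x + -3) * invFact (x + 0) * invFact (x + 1)) *
        (invFact (n - x - 1) * invFact (n - x + 2)))
      - 1 / (n - 2) * (intFact (n + -2) ^ 2 * invFact (n + -3) * intFact (n + x + -1) *
        (invFact (x + -2) * invFact (x + -1) * invFact (x + 2)) *
        (invFact (n - x - 1) * invFact (n - x + 0)))
      - 4 / (n - 2) * (intFact (n + -2) ^ 2 * invFact (n + -3) * intFact (n + x + -1) *
        (invFact (x + -3) * invFact (x + -1) * invFact (x + 2)) *
        (invFact (n - x - 1) * invFact (n - x + 1)))
      - 3 / (n - 2) * (intFact (n + -2) ^ 2 * invFact (n + -3) * intFact (n + x + -1) *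
        (invFact (x + -4) * invFact (x + -1) * invFact (x + 2)) *
        (invFact (n - x - 1) * invFact (n - x + 2)))
      + 1 / (n - 2) * (intFact (n + -2) ^ 2 * invFact (n + -4) * intFact (n + x + 0) *
        (invFact (x + -2) * invFact (x + -1) * invFact (x + 4)) *
        (invFact (n - x - 1) * invFact (n - x + 0))))
      - 24 * (intFact n * intFact (n + 2) * invFact (n + 1) * intFact (n + x + 1) *
        (invFact (x + -1) * invFact x * invFact (x + 1)) *
        (invFact (n - x - 1) * invFact (n - x + 3))) =
    certificate n (x + 1) - certificate n x := by
  have down : ∀ z w : ℤ, w = z - 1 → invFact w = z * invFact z := fun z w h => by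
    rw [h, invFact_sub_one]
  have up : ∀ z w : ℤ, 0 ≤ z → w = z + 1 → intFact w = (z + 1) * intFact z := fun z w hz h => by
    rw [h, intFact_add_one hz]
  have n1 : (n : ℚ) ≠ 0 := by norm_cast; omega
  have n2 : (n : ℚ) - 1 ≠ 0 := by norm_cast; omega
  have n3 : (n : ℚ) - 2 ≠ 0 := by norm_cast; omega
  have n4 : (n : ℚ) + 3 ≠ 0 := by norm_cast; omega
  rw [certificate, certificate, up (n + 1) (n + 2) (by omega) (by ring),
    up n (n + 1) (by omega) (by ring), add_zero n, add_zero x, add_zero (n + x), add_zero (n - x),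
    up (n + -1) n (by omega) (by ring), up (n + -2) (n + -1) (by omega) (by ring), sub_eq_add_neg n 2,
    up (n + x) (n + x + 1) (by omega) (by ring), up (n + x + -1) (n + x) (by omega) (by ring),
    show n + (x + 1) - 1 = n + x by ring, sub_eq_add_neg (n + x) 1,
    up (n + x + -1) (n + x) (by omega) (by ring),
    down (n + -3) (n + -4) (by ring), down (n + -2) (n + -3) (by ring),
    down (n + -1) (n + -2) (by ring), down n (n + -1) (by ring), down (n + 1) n (by ring),
    show x + 1 + 3 = x + 4 by ring, show x + 1 - 1 = x by ring, sub_eq_add_neg x 1,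
    down (x + -3) (x + -4) (by ring), down (x + -2) (x + -3) (by ring),
    down (x + -1) (x + -2) (by ring), down x (x + -1) (by ring), down (x + 1) x (by ring),
    down (x + 4) (x + 3) (by ring), down (n - x - 1) (n - (x + 1) - 1) (by ring),
    show n - (x + 1) + 3 = n - x + 2 by ring, down (x + 3) (x + 2) (by ring),
    down (x + 4) (x + 3) (by ring), down (n - x + 1) (n - x) (by ring),
    down (n - x + 2) (n - x + 1) (by ring), down (n - x + 3) (n - x + 2) (by ring)]
  have hv : invFact (x + 1) = (x + 2) * ((x + 3) * ((x + 4) * invFact (x + 4))) := by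
    rw [down (x + 2) (x + 1) (by ring), down (x + 3) (x + 2) (by ring),
      down (x + 4) (x + 3) (by ring)]
    push_cast
    ring
  rw [hv]
  generalize invFact (x + 4) = u
  generalize invFact (n - x - 1) = w
  generalize invFact (n - x + 3) = z
  generalize invFact (n + 1) = c
  generalize intFact (n + -2) = f
  generalize intFact (n + x + -1) = g
  push_cast
  generalize (n : ℚ) = n at *
  generalize (x : ℚ) = x at *
  field_simp
  simp only [certPoly]
  ring

lemma certificate_zero (n : ℤ) : certificate n 0 = 0 := by
  simp [certificate]

lemma certificate_self (n : ℤ) : certificate n n = 0 := by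
  rw [certificate, invFact_of_neg (z := n - n - 1) (by omega)]
  ring

lemma binomSum_combination_eq (m : ℕ) :
    ((m : ℚ) + 2 - 1) * (m + 2) ^ 2 * (m + 2 + 1) * (m + 2 + 2) * (
      1 / (m + 2) * binomSum (m + 2) 1 0 1 - 2 / (m + 2) * binomSum (m + 2) 2 1 1
      + 2 / (m + 1) * binomSum (m + 1) 2 3 2 + 3 / (m + 1) * binomSum (m + 1) 3 4 3
      - 1 / m * binomSum m 1 4 3 - 4 / m * binomSum m 2 5 4 - 3 / m * binomSum m 3 6 5
      + 1 / m * binomSum m 1 6 4) =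
    24 * ∑ j ∈ range (m + 2 + 1),
      ((m + 2).choose (j + 2) * (m + 2 + 2).choose j * (m + 2 + j + 2).choose (j + 1) : ℚ) := by
  rcases Nat.eq_zero_or_pos m with rfl | hm
  · norm_num [binomSum, sum_range_succ, Nat.choose]
  · have htel := sum_range_sub (fun j : ℕ => certificate (m + 2 : ℕ) j) (m + 2)
    rw [certificate_self, Nat.cast_zero, certificate_zero, sub_zero,
      sum_congr rfl fun j _ => show certificate (m + 2 : ℕ) (j + 1 : ℕ) - certificate (m + 2 : ℕ) j =
        _ from (telescoping_identity (n := (m + 2 : ℕ)) (x := j) (by omega) (by omega)).symm] at htel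
    rw [sum_choose_eq_sum_invFact (n := m + 2) (by omega),
      binomSum_eq_sum_invFact (n := m + 2) 0 0 0 1 0 0 1 1 (by omega) (by push_cast; omega)
        rfl rfl rfl rfl rfl rfl,
      binomSum_eq_sum_invFact (n := m + 2) 1 0 (-1) 1 0 1 0 0 (by omega) (by push_cast; omega)
        rfl rfl rfl rfl rfl rfl,
      binomSum_eq_sum_invFact (n := m + 2) 2 (-1) (-2) 0 1 1 (-1) (-2) (by omega)
        (by push_cast; omega) rfl rfl rfl rfl rfl rfl,
      binomSum_eq_sum_invFact (n := m + 2) 3 (-1) (-3) 0 1 2 (-1) (-2) (by omega)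
        (by push_cast; omega) rfl rfl rfl rfl rfl rfl,
      binomSum_eq_sum_invFact (n := m + 2) 2 (-2) (-2) (-1) 2 0 (-1) (-3) (by omega)
        (by push_cast; omega) rfl rfl rfl rfl rfl rfl,
      binomSum_eq_sum_invFact (n := m + 2) 3 (-2) (-3) (-1) 2 1 (-1) (-3) (by omega)
        (by push_cast; omega) rfl rfl rfl rfl rfl rfl,
      binomSum_eq_sum_invFact (n := m + 2) 4 (-2) (-4) (-1) 2 2 (-1) (-3) (by omega)
        (by push_cast; omega) rfl rfl rfl rfl rfl rfl,
      binomSum_eq_sum_invFact (n := m + 2) 2 (-2) (-2) (-1) 4 0 0 (-4) (by omega)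
        (by push_cast; omega) rfl rfl rfl rfl rfl rfl]
    rw [← sub_eq_zero, ← htel]
    simp only [mul_sum, ← sum_add_distrib, ← sum_sub_distrib]
    refine sum_congr rfl fun j _ => ?_
    rw [show (((m + 2 : ℕ) : ℤ) : ℚ) = m + 2 by push_cast; rfl,
      show (m : ℚ) + 2 - 1 = m + 1 by ring, show (m : ℚ) + 2 - 2 = m by ring]

end BinomialIdentity

/-- Theorem 3.13, first closed formula for the semi-Baxter numbers. -/
theorem semiBaxter_closed_formula_one (n : ℕ) (hn : 2 ≤ n) :
    ((n : ℤ) - 1) * (n : ℤ) ^ 2 * ((n : ℤ) + 1) * ((n : ℤ) + 2) * (semiBaxterCount n : ℤ) =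
      24 * ∑ j ∈ Finset.range (n + 1),
        (Nat.choose n (j + 2) * Nat.choose (n + 2) j * Nat.choose (n + j + 2) (j + 1) : ℤ) := by
  obtain ⟨m, rfl⟩ := Nat.exists_eq_add_of_le' hn
  have h := binomSum_combination_eq m
  rw [← semiBaxterCount_eq_binomSum] at h
  have h' : (((m + 2 : ℕ) : ℚ) - 1) * ((m + 2 : ℕ) : ℚ) ^ 2 * (((m + 2 : ℕ) : ℚ) + 1) *
      (((m + 2 : ℕ) : ℚ) + 2) * (semiBaxterCount (m + 2) : ℚ) =
      24 * ∑ j ∈ Finset.range (m + 2 + 1), ((m + 2).choose (j + 2) * (m + 2 + 2).choose j *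
        (m + 2 + j + 2).choose (j + 1) : ℚ) := by
    rw [← h]
    push_cast
    rfl
  exact_mod_cast h'
end
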